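/- For all 1 ≤ a, b ≤ m, the kernel of the surjective S-linear map from the degree-(b−a) homogeneous component of Cliff_S(q_φ) onto Hom_R(M_a, M_b) (given by restricting the Clifford action to M_a) equals the S-submodule Σ_{k > m} Λ^{k−b}(S^m)^∨ · Λ^{k−a}S^n + Σ_{l ≤ 0} Λ^{b−l}S^n · Λ^{a−l}(S^m)^∨ of Cliff_S(q_φ), where Λ^p(S^m)^∨ and Λ^qS^n are identified with their canonical images in Cliff_S(q_φ), products are taken inside Cliff_S(q_φ), and only the finitely many summands with exponents in the admissible ranges 0 ≤ k−b ≤ m, 0 ≤ k−a ≤ n, 0 ≤ b−l ≤ n, 0 ≤ a−l ≤ m are nonzero. -/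

import Mathlib

/-!
STATEMENT 19: With `K` a field, `m ≤ n` positive integers, `S = K[x_{ij}]`, `φ : S^n → S^m`
the generic map, `M_a = coker(Λ^a φ)` and the Clifford algebra `Cliff_S(q_φ)` acting on
`M = ⊕_{a=1}^m M_a` (`λ ∈ (S^m)^∨` acting by the contraction operators `∂_λ`, `g ∈ S^n` by
the exterior multiplication operators `θ_g`):  for all `1 ≤ a, b ≤ m`, the kernel of the
surjective map from the degree-`(b−a)` homogeneous component of `Cliff_S(q_φ)` (for the
`ℤ`-grading with `deg λ = −1`, `deg g = +1`) onto `Hom_R(M_a, M_b)` given by restricting the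
Clifford action to `M_a` equals the submodule
`Σ_{k>m} Λ^{k−b}(S^m)^∨ · Λ^{k−a}S^n + Σ_{l≤0} Λ^{b−l}S^n · Λ^{a−l}(S^m)^∨` of
`Cliff_S(q_φ)` (products taken in the Clifford algebra; summands with out-of-range exponents
vanish automatically).

We realize `M` as `Λ S^m / image(Λ φ)`, whose degree-`a` component is `M_a`; the Clifford
action is the `S`-algebra morphism `ρ : Cliff_S(q_φ) → End_S(M)` determined (uniquely) by the
commuting-square hypotheses below.  The degree-`d` component of the Clifford algebra is the
span of the products of generators of total degree `d`, and `Λ^p (S^m)^∨`, `Λ^q S^n` denote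
the spans of the `p`-fold (resp. `q`-fold) products of the corresponding generators.  An
element of the degree-`(b−a)` component maps `M_a` into `M_b`, and it lies in the kernel of
the restriction map iff it annihilates the component `M_a ⊆ M`, i.e. the image of `⋀^a S^m`.
-/

noncomputable section

variable (K : Type) [Field K] (m n : ℕ)

/-- `S = K[x_{ij}]`. -/
abbrev detS (K : Type) [Field K] (m n : ℕ) : Type := MvPolynomial (Fin m × Fin n) K

/-- The generic matrix `X`. -/
def genX (K : Type) [Field K] (m n : ℕ) : Matrix (Fin m) (Fin n) (detS K m n) :=
  fun i j => MvPolynomial.X (i, j)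

/-- The generic map `φ : S^n → S^m`. -/
def genφ (K : Type) [Field K] (m n : ℕ) :
    (Fin n → detS K m n) →ₗ[detS K m n] (Fin m → detS K m n) :=
  Matrix.toLin' (genX K m n)

/-- `M = Λ S^m / image(Λ φ) = ⊕_{a=1}^m coker(Λ^a φ)`. -/
abbrev detM (K : Type) [Field K] (m n : ℕ) : Type :=
  ExteriorAlgebra (detS K m n) (Fin m → detS K m n) ⧸
    LinearMap.range (ExteriorAlgebra.map (genφ K m n)).toLinearMap

/-- The projection `π : Λ S^m → M`. -/
def detπ (K : Type) [Field K] (m n : ℕ) :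
    ExteriorAlgebra (detS K m n) (Fin m → detS K m n) →ₗ[detS K m n] detM K m n :=
  Submodule.mkQ _

/-- The bilinear form `(λ ⊕ g, λ' ⊕ g') ↦ λ(φ(g'))` on `(S^m)^∨ ⊕ S^n`. -/
def qφBilin (K : Type) [Field K] (m n : ℕ) :
    (Module.Dual (detS K m n) (Fin m → detS K m n) × (Fin n → detS K m n)) →ₗ[detS K m n]
    (Module.Dual (detS K m n) (Fin m → detS K m n) × (Fin n → detS K m n)) →ₗ[detS K m n]
      detS K m n :=
  LinearMap.mk₂ (detS K m n) (fun p q => p.1 (genφ K m n q.2))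
    (fun p p' q => by simp)
    (fun c p q => by simp)
    (fun p q q' => by simp)
    (fun c p q => by simp)

/-- The quadratic form `q_φ(λ ⊕ g) = λ(φ(g))`. -/
def qφ (K : Type) [Field K] (m n : ℕ) :
    QuadraticForm (detS K m n)
      (Module.Dual (detS K m n) (Fin m → detS K m n) × (Fin n → detS K m n)) :=
  LinearMap.BilinMap.toQuadraticMap (qφBilin K m n)

/-- Left contraction with `λ` on the exterior algebra `Λ S^m`. -/
def ctr (lam : Module.Dual (detS K m n) (Fin m → detS K m n)) :
    ExteriorAlgebra (detS K m n) (Fin m → detS K m n) →ₗ[detS K m n]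
      ExteriorAlgebra (detS K m n) (Fin m → detS K m n) :=
  CliffordAlgebra.contractLeft (Q := (0 : QuadraticForm (detS K m n) (Fin m → detS K m n))) lam

/-- The generators of the Clifford algebra `Cliff_S(q_φ)`: the `λ ∈ (S^m)^∨` (degree `−1`)
and the `g ∈ S^n` (degree `+1`). -/
def cliffGen (K : Type) [Field K] (m n : ℕ) :
    (Module.Dual (detS K m n) (Fin m → detS K m n) ⊕ (Fin n → detS K m n)) →
      CliffordAlgebra (qφ K m n)
  | Sum.inl d => CliffordAlgebra.ι (qφ K m n) (d, 0)
  | Sum.inr g => CliffordAlgebra.ι (qφ K m n) (0, g)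

/-- The degree of a generator: `deg λ = −1`, `deg g = +1`. -/
def genDeg (K : Type) [Field K] (m n : ℕ) :
    (Module.Dual (detS K m n) (Fin m → detS K m n) ⊕ (Fin n → detS K m n)) → ℤ
  | Sum.inl _ => -1
  | Sum.inr _ => 1

/-- The degree-`d` homogeneous component of `Cliff_S(q_φ)` for the `ℤ`-grading with
`deg λ = −1`, `deg g = +1`: the span of the products of generators of total degree `d`. -/
def cliffDeg (K : Type) [Field K] (m n : ℕ) (d : ℤ) :
    Submodule (detS K m n) (CliffordAlgebra (qφ K m n)) :=
  Submodule.span (detS K m n)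
    {x | ∃ l : List (Module.Dual (detS K m n) (Fin m → detS K m n) ⊕ (Fin n → detS K m n)),
      (l.map (genDeg K m n)).sum = d ∧ x = (l.map (cliffGen K m n)).prod}

/-- The canonical image of `Λ^p (S^m)^∨` in `Cliff_S(q_φ)`: the span of the `p`-fold products
of generators `λ ∈ (S^m)^∨`. -/
def lamPow (K : Type) [Field K] (m n p : ℕ) :
    Submodule (detS K m n) (CliffordAlgebra (qφ K m n)) :=
  Submodule.span (detS K m n)
    {x | ∃ l : List (Module.Dual (detS K m n) (Fin m → detS K m n)), l.length = p ∧
      x = (l.map (fun d => CliffordAlgebra.ι (qφ K m n) (d, 0))).prod}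

/-- The canonical image of `Λ^q S^n` in `Cliff_S(q_φ)`: the span of the `q`-fold products of
generators `g ∈ S^n`. -/
def gPow (K : Type) [Field K] (m n q : ℕ) :
    Submodule (detS K m n) (CliffordAlgebra (qφ K m n)) :=
  Submodule.span (detS K m n)
    {x | ∃ l : List (Fin n → detS K m n), l.length = q ∧
      x = (l.map (fun g => CliffordAlgebra.ι (qφ K m n) (0, g))).prod}

/-- A Clifford-type algebra `C` generated by anticommuting families `lam`, `gen` acting on a module
`V` equipped with creation operators `e`, a vacuum vector and a vacuum functional, such that `lam`
acts by the annihilation operators and `gen k` by `∑ i, x i k • e i`. -/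
structure FockSystem (S C V ι κ : Type*) [CommRing S] [Ring C] [Algebra S C] [AddCommGroup V]
    [Module S V] [Fintype ι] [DecidableEq ι] where
  x : ι → κ → S
  lam : ι → C
  gen : κ → C
  inv : C →ₐ[S] C
  act : C →ₐ[S] Module.End S V
  e : ι → Module.End S V
  vac : V
  cov₀ : V →ₗ[S] S
  lam_sq : ∀ i, lam i * lam i = 0
  lam_lam : ∀ i j, lam i * lam j = -(lam j * lam i)
  gen_sq : ∀ k, gen k * gen k = 0
  gen_gen : ∀ k l, gen k * gen l = -(gen l * gen k)
  gen_lam : ∀ i k, gen k * lam i = algebraMap S C (x i k) - lam i * gen k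
  inv_lam : ∀ i, inv (lam i) = -lam i
  inv_gen : ∀ k, inv (gen k) = -gen k
  inv_inv : ∀ w, inv (inv w) = w
  e_sq : ∀ i v, e i (e i v) = 0
  e_e : ∀ i j v, e i (e j v) = -e j (e i v)
  act_lam_e : ∀ i j v, act (lam i) (e j v) = (if i = j then v else 0) - e j (act (lam i) v)
  act_gen : ∀ k v, act (gen k) v = ∑ i, x i k • e i v
  cov₀_vac : cov₀ vac = 1
  cov₀_e : ∀ i v, cov₀ (e i v) = 0
  act_lam_vac : ∀ i, act (lam i) vac = 0

namespace FockSystem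

variable {S C V ι κ : Type*} [CommRing S] [Ring C] [Algebra S C] [AddCommGroup V]
    [Module S V] [Fintype ι] [DecidableEq ι] (D : FockSystem S C V ι κ)

/-- The state obtained from the vacuum by creating the indices of a list. -/
def vec : List ι → V
  | [] => D.vac
  | i :: l => D.e i (vec l)

/-- The functional annihilating the indices of a list and projecting to the vacuum. -/
def cov : List ι → V →ₗ[S] S
  | [] => D.cov₀
  | i :: l => (cov l).comp (D.act (D.lam i))

/-- The product of the `lam`s along a list. -/
def lamProd (l : List ι) : C := (l.map D.lam).prod

/-- The product of the `gen`s along a list. -/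
def genProd (l : List κ) : C := (l.map D.gen).prod

/-- The subring generated by the scalars in `A`, the `lam i`, `i ∈ U`, and the `gen k`, `k ∈ W`. -/
def sub (A : Subring S) (U : Finset ι) (W : Finset κ) : Subring C :=
  Subring.closure (algebraMap S C '' A ∪ D.lam '' U ∪ D.gen '' W)

section sub

variable {D} {A A' : Subring S} {U U' : Finset ι} {W W' : Finset κ}

theorem scalar_mem {s : S} (hs : s ∈ A) : algebraMap S C s ∈ D.sub A U W :=
  Subring.subset_closure (.inl (.inl ⟨s, hs, rfl⟩))

theorem lam_mem {i : ι} (hi : i ∈ U) : D.lam i ∈ D.sub A U W :=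
  Subring.subset_closure (.inl (.inr ⟨i, hi, rfl⟩))

theorem gen_mem {k : κ} (hk : k ∈ W) : D.gen k ∈ D.sub A U W :=
  Subring.subset_closure (.inr ⟨k, hk, rfl⟩)

theorem sub_mono (hA : A ≤ A') (hU : U ⊆ U') (hW : W ⊆ W') : D.sub A U W ≤ D.sub A' U' W' :=
  Subring.closure_mono (Set.union_subset_union (Set.union_subset_union
    (Set.image_mono hA) (Set.image_mono (by simpa using hU))) (Set.image_mono (by simpa using hW)))

theorem sub_induction {p : C → Prop} (scalar : ∀ s ∈ A, p (algebraMap S C s))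
    (lam : ∀ i ∈ U, p (D.lam i)) (gen : ∀ k ∈ W, p (D.gen k))
    (add : ∀ x y, p x → p y → p (x + y)) (mul : ∀ x y, p x → p y → p (x * y))
    {w : C} (hw : w ∈ D.sub A U W) : p w := by
  induction hw using Subring.closure_induction with
  | mem x hx =>
    obtain (⟨s, hs, rfl⟩ | ⟨i, hi, rfl⟩) | ⟨k, hk, rfl⟩ := hx
    exacts [scalar s hs, lam i hi, gen k hk]
  | zero => simpa using scalar 0 A.zero_mem
  | one => simpa using scalar 1 A.one_mem
  | add x y _ _ hx hy => exact add x y hx hy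
  | neg x _ hx => simpa using mul _ _ (scalar (-1) (A.neg_mem A.one_mem)) hx
  | mul x y _ _ hx hy => exact mul x y hx hy

theorem genProd_mem {l : List κ} (hl : ∀ i ∈ l, i ∈ W) : D.genProd l ∈ D.sub A U W :=
  Subring.list_prod_mem _ (by simpa using fun i hi => gen_mem (hl i hi))

theorem inv_mem {w : C} (hw : w ∈ D.sub A U W) : D.inv w ∈ D.sub A U W := by
  refine sub_induction (p := fun w => D.inv w ∈ D.sub A U W) (fun s hs => ?_) (fun i hi => ?_)
    (fun k hk => ?_) (fun x y hx hy => ?_) (fun x y hx hy => ?_) hw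
  · simpa using scalar_mem hs
  · simpa [D.inv_lam] using lam_mem hi
  · simpa [D.inv_gen] using gen_mem hk
  · simpa using add_mem hx hy
  · simpa using mul_mem hx hy

end sub

/-- The left ideal of `D.sub A U W` generated by `p`-fold products of `lam`s and `q`-fold products
of `gen`s. -/
def leftIdeal (A : Subring S) (U : Finset ι) (W : Finset κ) (p q : ℕ) : AddSubgroup C :=
  AddSubgroup.closure {w | ∃ u ∈ D.sub A U W,
    (∃ l : List ι, l.length = p ∧ (∀ i ∈ l, i ∈ U) ∧ w = u * D.lamProd l) ∨
    (∃ l : List κ, l.length = q ∧ (∀ k ∈ l, k ∈ W) ∧ w = u * D.genProd l)}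

section leftIdeal

variable {D} {A A' : Subring S} {U U' : Finset ι} {W W' : Finset κ} {p q : ℕ}

theorem mul_lamProd_mem {u : C} (hu : u ∈ D.sub A U W) {l : List ι} (hl : ∀ i ∈ l, i ∈ U) :
    u * D.lamProd l ∈ D.leftIdeal A U W l.length q :=
  AddSubgroup.subset_closure ⟨u, hu, .inl ⟨l, rfl, hl, rfl⟩⟩

theorem mul_genProd_mem {u : C} (hu : u ∈ D.sub A U W) {l : List κ} (hl : ∀ i ∈ l, i ∈ W) :
    u * D.genProd l ∈ D.leftIdeal A U W p l.length :=
  AddSubgroup.subset_closure ⟨u, hu, .inr ⟨l, rfl, hl, rfl⟩⟩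

theorem leftIdeal_induction {P : C → Prop}
    (lam : ∀ u ∈ D.sub A U W, ∀ l : List ι, l.length = p → (∀ i ∈ l, i ∈ U) → P (u * D.lamProd l))
    (gen : ∀ u ∈ D.sub A U W, ∀ l : List κ, l.length = q → (∀ i ∈ l, i ∈ W) → P (u * D.genProd l))
    (add : ∀ x y, P x → P y → P (x + y)) (zero : P 0) {w : C}
    (hw : w ∈ D.leftIdeal A U W p q) : P w := by
  suffices h : P w ∧ P (-w) from h.1
  induction hw using AddSubgroup.closure_induction with
  | mem x hx =>
    obtain ⟨u, hu, ⟨l, hl, hlU, rfl⟩ | ⟨l, hl, hlU, rfl⟩⟩ := hx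
    · exact ⟨lam u hu l hl hlU, by simpa using lam (-u) (neg_mem hu) l hl hlU⟩
    · exact ⟨gen u hu l hl hlU, by simpa using gen (-u) (neg_mem hu) l hl hlU⟩
  | zero => simpa using zero
  | add x y _ _ hx hy => exact ⟨add _ _ hx.1 hy.1, by simpa [add_comm] using add _ _ hx.2 hy.2⟩
  | neg x _ hx => exact ⟨hx.2, by simpa using hx.1⟩

theorem mul_mem_leftIdeal {u w : C} (hu : u ∈ D.sub A U W) (hw : w ∈ D.leftIdeal A U W p q) :
    u * w ∈ D.leftIdeal A U W p q := by
  refine leftIdeal_induction (P := fun w => u * w ∈ D.leftIdeal A U W p q)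
    (fun u' hu' l hl hlU => ?_) (fun u' hu' l hl hlU => ?_) (fun x y hx hy => ?_) (by simp) hw
  · subst hl; rw [← mul_assoc]; exact mul_lamProd_mem (mul_mem hu hu') hlU
  · subst hl; rw [← mul_assoc]; exact mul_genProd_mem (mul_mem hu hu') hlU
  · rw [mul_add]; exact add_mem hx hy

theorem leftIdeal_mono (hA : A ≤ A') (hU : U ⊆ U') (hW : W ⊆ W') :
    D.leftIdeal A U W p q ≤ D.leftIdeal A' U' W' p q := by
  refine AddSubgroup.closure_mono ?_
  rintro w ⟨u, hu, ⟨l, hl, hlU, rfl⟩ | ⟨l, hl, hlU, rfl⟩⟩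
  · exact ⟨u, sub_mono hA hU hW hu, .inl ⟨l, hl, fun i hi => hU (hlU i hi), rfl⟩⟩
  · exact ⟨u, sub_mono hA hU hW hu, .inr ⟨l, hl, fun i hi => hW (hlU i hi), rfl⟩⟩

theorem mem_leftIdeal_zero_right {w : C} (hw : w ∈ D.sub A U W) :
    w ∈ D.leftIdeal A U W p 0 := by
  simpa [genProd] using mul_genProd_mem (p := p) hw (l := []) (by simp)

theorem leftIdeal_succ_right_le : D.leftIdeal A U W p (q + 1) ≤ D.leftIdeal A U W p q := by
  refine fun w hw => leftIdeal_induction (P := fun w => w ∈ D.leftIdeal A U W p q)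
    (fun u' hu' l hl hlU => ?_) (fun u' hu' l hl hlU => ?_) (fun x y hx hy => add_mem hx hy)
    (by simp) hw
  · subst hl; exact mul_lamProd_mem hu' hlU
  · obtain _ | ⟨k, l⟩ := l
    · simp at hl
    · obtain rfl : l.length = q := by simpa using hl
      have := mul_genProd_mem (p := p) (mul_mem hu' (gen_mem (hlU k (by simp)))) (l := l)
        fun i hi => hlU i (by simp [hi])
      simpa [genProd, mul_assoc] using this

theorem leftIdeal_empty_gen_le (q' : ℕ) :
    D.leftIdeal A U ∅ p (q + 1) ≤ D.leftIdeal A U ∅ p q' := by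
  refine fun w hw => leftIdeal_induction (P := fun w => w ∈ D.leftIdeal A U ∅ p q')
    (fun u' hu' l hl hlU => ?_) (fun u' hu' l hl hlU => ?_) (fun x y hx hy => add_mem hx hy)
    (by simp) hw
  · subst hl; exact mul_lamProd_mem hu' hlU
  · obtain _ | ⟨k, l⟩ := l
    · simp at hl
    · simpa using hlU k (by simp)

theorem genProd_mul_lam_mem {i : ι} (hi : i ∈ U) (hx : ∀ k ∈ W, D.x i k ∈ A) (l : List κ) :
    ∀ u ∈ D.sub A U W, ∀ m : List κ, (∀ k ∈ l, k ∈ W) → (∀ k ∈ m, k ∈ W) →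
      u * D.genProd l * D.lam i * D.genProd m ∈
        D.leftIdeal A U W p (l.length - 1 + m.length) := by
  induction l using List.reverseRecOn with
  | nil =>
    intro u hu m _ hm
    simpa [genProd] using mul_genProd_mem (p := p) (mul_mem hu (lam_mem hi)) hm
  | append_singleton l k ih =>
    intro u hu m hl hm
    have hk : k ∈ W := hl k (by simp)
    have hl' : ∀ k ∈ l, k ∈ W := fun k hk => hl k (by simp [hk])
    have e1 : u * D.genProd (l ++ [k]) * D.lam i * D.genProd m =
        (algebraMap S C (D.x i k) * u) * D.genProd (l ++ m)
          - u * D.genProd l * D.lam i * D.genProd (k :: m) := by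
      have : u * D.genProd (l ++ [k]) * D.lam i * D.genProd m =
        u * D.genProd l * (D.gen k * D.lam i) * D.genProd m := by simp [genProd, mul_assoc]
      rw [this, D.gen_lam, mul_sub, sub_mul, ← Algebra.commutes, ← mul_assoc]
      simp [genProd, mul_assoc]
    rw [e1]
    refine sub_mem ?_ ?_
    · have := mul_genProd_mem (p := p) (mul_mem (scalar_mem (hx k hk)) hu) (l := l ++ m)
        (by simpa using fun j hj => hj.elim (hl' j) (hm j))
      simpa using this
    · have := ih u hu (k :: m) hl' (by simpa using ⟨hk, hm⟩)
      obtain _ | ⟨k', l⟩ := l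
      · exact leftIdeal_succ_right_le (by simpa using this)
      · have e2 : (k' :: l).length - 1 + (k :: m).length = ((k' :: l) ++ [k]).length - 1 + m.length := by
          simp; omega
        rwa [e2] at this

/-- Right multiplication by `lam i` sends the left ideal for `(p, q + 1)` to that for
`(p + 1, q)`. -/
theorem mul_lam_mem_leftIdeal {i : ι} (hi : i ∈ U) (hx : ∀ k ∈ W, D.x i k ∈ A) {w : C}
    (hw : w ∈ D.leftIdeal A U W p (q + 1)) : w * D.lam i ∈ D.leftIdeal A U W (p + 1) q := by
  refine leftIdeal_induction (P := fun w => w * D.lam i ∈ D.leftIdeal A U W (p + 1) q)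
    (fun u hu l hl hlU => ?_) (fun u hu l hl hlU => ?_) (fun x y hx hy => ?_) (by simp) hw
  · have := mul_lamProd_mem (q := q) hu (l := l ++ [i]) (by
      simpa using fun j hj => hj.elim (hlU j) (fun h => h ▸ hi))
    subst hl
    simpa [lamProd, mul_assoc] using this
  · have := genProd_mul_lam_mem (p := p + 1) hi hx l u hu [] hlU (by simp)
    simpa [genProd, hl] using this
  · rw [add_mul]; exact add_mem hx hy

end leftIdeal

/-- The vectors annihilated by all functionals `D.cov L` with `L` supported in `U`, i.e. the span of
the images of the `e i` with `i ∉ U`. -/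
def null (U : Finset ι) : Submodule S V where
  carrier := {v | ∀ L : List ι, (∀ i ∈ L, i ∈ U) → D.cov L v = 0}
  add_mem' hv hw L hL := by rw [map_add, hv L hL, hw L hL, add_zero]
  zero_mem' L _ := map_zero _
  smul_mem' c v hv L hL := by rw [map_smul, hv L hL, smul_zero]

section null

variable {D} {A : Subring S} {U U' : Finset ι} {W : Finset κ}

theorem null_anti (h : U ⊆ U') : D.null U' ≤ D.null U :=
  fun _ hv L hL => hv L fun i hi => h (hL i hi)

theorem act_lam_mem_null {i : ι} (hi : i ∈ U) {v : V} (hv : v ∈ D.null U) :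
    D.act (D.lam i) v ∈ D.null U :=
  fun L hL => hv (i :: L) (by simpa using ⟨hi, hL⟩)

theorem e_mem_null (i : ι) {v : V} (hv : v ∈ D.null U) : D.e i v ∈ D.null U := by
  intro L
  induction L generalizing v with
  | nil => exact fun _ => D.cov₀_e i v
  | cons l L ih =>
    intro hL
    simp only [List.mem_cons, forall_eq_or_imp] at hL
    change D.cov L (D.act (D.lam l) (D.e i v)) = 0
    rw [D.act_lam_e, map_sub, ih (act_lam_mem_null hL.1 hv) hL.2, sub_zero]
    split_ifs
    exacts [hv L hL.2, map_zero _]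

theorem e_mem_null_of_notMem {i : ι} (hi : i ∉ U) (v : V) : D.e i v ∈ D.null U := by
  intro L
  induction L generalizing v with
  | nil => exact fun _ => D.cov₀_e i v
  | cons l L ih =>
    intro hL
    simp only [List.mem_cons, forall_eq_or_imp] at hL
    change D.cov L (D.act (D.lam l) (D.e i v)) = 0
    rw [D.act_lam_e, map_sub, ih _ hL.2, if_neg (by rintro rfl; exact hi hL.1)]
    simp

theorem act_gen_mem_null (k : κ) {v : V} (hv : v ∈ D.null U) : D.act (D.gen k) v ∈ D.null U := by
  rw [D.act_gen]
  exact Submodule.sum_mem _ fun i _ => Submodule.smul_mem _ _ (e_mem_null i hv)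

theorem act_mem_null {w : C} (hw : w ∈ D.sub A U W) {v : V} (hv : v ∈ D.null U) :
    D.act w v ∈ D.null U := by
  refine sub_induction (p := fun w => ∀ v ∈ D.null U, D.act w v ∈ D.null U)
    (fun s _ v hv => ?_) (fun i hi v hv => act_lam_mem_null hi hv)
    (fun k _ v hv => act_gen_mem_null k hv) (fun x y hx hy v hv => ?_)
    (fun x y hx hy v hv => ?_) hw v hv
  · simpa [Module.algebraMap_end_apply] using Submodule.smul_mem _ s hv
  · simpa using add_mem (hx v hv) (hy v hv)
  · simpa using hx _ (hy v hv)

theorem act_e {i : ι} (hi : i ∉ U) {w : C} (hw : w ∈ D.sub A U W) (v : V) :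
    D.act w (D.e i v) = D.e i (D.act (D.inv w) v) := by
  refine sub_induction (p := fun w => ∀ v, D.act w (D.e i v) = D.e i (D.act (D.inv w) v))
    (fun s _ v => ?_) (fun j hj v => ?_)
    (fun k _ v => ?_) (fun x y hx hy v => ?_)
    (fun x y hx hy v => ?_) hw v
  · simp [Module.algebraMap_end_apply]
  · rw [D.act_lam_e, if_neg (by rintro rfl; exact hi hj), D.inv_lam]; simp
  · rw [D.act_gen, D.inv_gen, map_neg, LinearMap.neg_apply, D.act_gen, map_neg, map_sum,
      ← Finset.sum_neg_distrib]
    refine Finset.sum_congr rfl fun j _ => ?_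
    rw [map_smul, D.e_e j i, smul_neg]
  · simp [hx, hy]
  · simp [hx, hy]

theorem act_lam_vec {i : ι} {K : List ι} (hi : i ∉ K) : D.act (D.lam i) (D.vec K) = 0 := by
  induction K with
  | nil => exact D.act_lam_vac i
  | cons j K ih =>
    simp only [List.mem_cons, not_or] at hi
    change D.act (D.lam i) (D.e j (D.vec K)) = 0
    rw [D.act_lam_e, if_neg hi.1, ih hi.2]; simp

theorem act_lam_vec_cons {i : ι} {K : List ι} (hi : i ∉ K) :
    D.act (D.lam i) (D.vec (i :: K)) = D.vec K := by
  change D.act (D.lam i) (D.e i (D.vec K)) = _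
  rw [D.act_lam_e, if_pos rfl, act_lam_vec hi]; simp

theorem e_vec_of_mem {i : ι} {K : List ι} (hi : i ∈ K) : D.e i (D.vec K) = 0 := by
  induction K with
  | nil => simp at hi
  | cons j K ih =>
    change D.e i (D.e j (D.vec K)) = 0
    by_cases h : i = j
    · rw [h, D.e_sq]
    · rw [D.e_e, ih (by simpa [h] using hi)]; simp

theorem vec_of_not_nodup {K : List ι} (hK : ¬ K.Nodup) : D.vec K = 0 := by
  induction K with
  | nil => simp at hK
  | cons j K ih =>
    change D.e j (D.vec K) = 0
    by_cases h : j ∈ K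
    · exact e_vec_of_mem h
    · rw [ih (by simpa [h] using hK), map_zero]

theorem vec_mem_null_of_card_lt {K : List ι} (hK : U.card < K.length) : D.vec K ∈ D.null U := by
  by_cases hd : K.Nodup
  · by_cases hU : ∀ i ∈ K, i ∈ U
    · have : K.toFinset ⊆ U := fun i hi => hU i (by simpa using hi)
      have := Finset.card_le_card this
      rw [List.toFinset_card_of_nodup hd] at this
      omega
    · push Not at hU
      obtain ⟨i, hi, hiU⟩ := hU
      clear hd hK
      induction K with
      | nil => simp at hi
      | cons j K ih =>
        change D.e j (D.vec K) ∈ _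
        rcases List.mem_cons.1 hi with rfl | hi
        · exact e_mem_null_of_notMem hiU _
        · exact e_mem_null j (ih hi)
  · rw [vec_of_not_nodup hd]; exact zero_mem _

theorem act_genProd_vec_mem_null (l : List κ) :
    ∀ K : List ι, U.card < l.length + K.length → D.act (D.genProd l) (D.vec K) ∈ D.null U := by
  induction l using List.reverseRecOn with
  | nil => intro K hK; simpa [genProd] using vec_mem_null_of_card_lt (by simpa using hK)
  | append_singleton l k ih =>
    intro K hK
    have : D.act (D.genProd (l ++ [k])) (D.vec K)
        = ∑ i, D.x i k • D.act (D.genProd l) (D.vec (i :: K)) := by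
      simp [genProd, D.act_gen, vec]
    rw [this]
    refine Submodule.sum_mem _ fun i _ => Submodule.smul_mem _ _ (ih _ ?_)
    simp at hK ⊢; omega

theorem act_lam_vec_mem_span (i : ι) (K : List ι) :
    D.act (D.lam i) (D.vec K) ∈
      Submodule.span S {v | ∃ K' : List ι, K'.length + 1 = K.length ∧ v = D.vec K'} := by
  induction K with
  | nil => simp [vec, D.act_lam_vac]
  | cons j K ih =>
    change D.act (D.lam i) (D.e j (D.vec K)) ∈ _
    rw [D.act_lam_e]
    refine sub_mem ?_ ?_
    · split_ifs
      exacts [Submodule.subset_span ⟨K, by simp, rfl⟩, zero_mem _]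
    · have := Submodule.mem_map_of_mem (f := D.e j) ih
      rw [Submodule.map_span] at this
      refine Submodule.span_mono ?_ this
      rintro _ ⟨_, ⟨K', hK', rfl⟩, rfl⟩
      exact ⟨j :: K', by simpa using hK', rfl⟩

theorem act_lamProd_vec_eq_zero (l : List ι) :
    ∀ K : List ι, K.length < l.length → D.act (D.lamProd l) (D.vec K) = 0 := by
  induction l using List.reverseRecOn with
  | nil => intro K hK; simp at hK
  | append_singleton l i ih =>
    intro K hK
    have h1 : D.act (D.lamProd (l ++ [i])) (D.vec K)
        = D.act (D.lamProd l) (D.act (D.lam i) (D.vec K)) := by simp [lamProd]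
    have h2 : Submodule.span S {v | ∃ K' : List ι, K'.length + 1 = K.length ∧ v = D.vec K'} ≤
        LinearMap.ker (D.act (D.lamProd l)) := by
      rw [Submodule.span_le]
      rintro _ ⟨K', hK', rfl⟩
      exact ih K' (by simp at hK; omega)
    rw [h1]
    exact h2 (act_lam_vec_mem_span i K)

theorem act_vec_mem_null_of_mem_leftIdeal {a q : ℕ} (haq : U.card < a + q) {w : C}
    (hw : w ∈ D.leftIdeal A U W (a + 1) q) {K : List ι} (hK : K.length = a) :
    D.act w (D.vec K) ∈ D.null U := by
  refine leftIdeal_induction (P := fun w => D.act w (D.vec K) ∈ D.null U)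
    (fun u hu l hl hlU => ?_) (fun u hu l hl hlU => ?_) (fun x y hx hy => ?_) (by simp) hw
  · simp [act_lamProd_vec_eq_zero l K (by omega)]
  · rw [map_mul]
    exact act_mem_null hu (act_genProd_vec_mem_null l K (by omega))
  · simpa using add_mem hx hy

end null

section decomposition

variable {D} {A : Subring S} {U : Finset ι} {W : Finset κ}

theorem exists_eq_add_mul_lam [DecidableEq κ] {i : ι} (hx : ∀ k ∈ W, D.x i k ∈ A) {w : C}
    (hw : w ∈ D.sub A (insert i U) W) :
    ∃ u₀ ∈ D.sub A U W, ∃ u₁ ∈ D.sub A U W, w = u₀ + u₁ * D.lam i := by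
  suffices h : ∀ z, (∃ u₀ ∈ D.sub A U W, ∃ u₁ ∈ D.sub A U W, z = u₀ + u₁ * D.lam i) →
      ∃ u₀ ∈ D.sub A U W, ∃ u₁ ∈ D.sub A U W, z * w = u₀ + u₁ * D.lam i by
    simpa using h 1 ⟨1, one_mem _, 0, zero_mem _, by simp⟩
  refine sub_induction (p := fun w => ∀ z, (∃ u₀ ∈ D.sub A U W, ∃ u₁ ∈ D.sub A U W,
      z = u₀ + u₁ * D.lam i) → ∃ u₀ ∈ D.sub A U W, ∃ u₁ ∈ D.sub A U W, z * w = u₀ + u₁ * D.lam i)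
    ?_ ?_ ?_ ?_ ?_ hw
  · rintro s hs _ ⟨u₀, h₀, u₁, h₁, rfl⟩
    refine ⟨_, mul_mem (scalar_mem hs) h₀, _, mul_mem (scalar_mem hs) h₁, ?_⟩
    rw [← Algebra.commutes, mul_add, mul_assoc]
  · rintro j hj _ ⟨u₀, h₀, u₁, h₁, rfl⟩
    by_cases hij : j = i
    · subst hij
      exact ⟨0, zero_mem _, u₀, h₀, by rw [add_mul, mul_assoc, D.lam_sq]; simp⟩
    · have hj : j ∈ U := by simpa [hij] using hj
      refine ⟨_, mul_mem h₀ (lam_mem hj), _, neg_mem (mul_mem h₁ (lam_mem hj)), ?_⟩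
      rw [add_mul, mul_assoc u₁, D.lam_lam i j]; noncomm_ring
  · rintro k hk _ ⟨u₀, h₀, u₁, h₁, rfl⟩
    refine ⟨_, add_mem (mul_mem h₀ (gen_mem hk)) (mul_mem h₁ (scalar_mem (hx k hk))), _,
      neg_mem (mul_mem h₁ (gen_mem hk)), ?_⟩
    have : D.lam i * D.gen k = algebraMap S C (D.x i k) - D.gen k * D.lam i := by
      rw [D.gen_lam]; abel
    rw [add_mul, mul_assoc u₁, this]; noncomm_ring
  · intro x y hx hy z hz
    obtain ⟨u₀, h₀, u₁, h₁, e⟩ := hx z hz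
    obtain ⟨v₀, k₀, v₁, k₁, e'⟩ := hy z hz
    exact ⟨_, add_mem h₀ k₀, _, add_mem h₁ k₁, by rw [mul_add, e, e']; noncomm_ring⟩
  · intro x y hx hy z hz
    rw [← mul_assoc]
    exact hy _ (hx z hz)

theorem exists_eq_add_gen_mul [DecidableEq κ] {h : κ} (hx : ∀ i ∈ U, D.x i h ∈ A) {w : C}
    (hw : w ∈ D.sub A U (insert h W)) :
    ∃ u₀ ∈ D.sub A U W, ∃ u₁ ∈ D.sub A U W, w = u₀ + D.gen h * u₁ := by
  suffices H : ∀ z, (∃ u₀ ∈ D.sub A U W, ∃ u₁ ∈ D.sub A U W, z = u₀ + D.gen h * u₁) →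
      ∃ u₀ ∈ D.sub A U W, ∃ u₁ ∈ D.sub A U W, w * z = u₀ + D.gen h * u₁ by
    simpa using H 1 ⟨1, one_mem _, 0, zero_mem _, by simp⟩
  refine sub_induction (p := fun w => ∀ z, (∃ u₀ ∈ D.sub A U W, ∃ u₁ ∈ D.sub A U W,
      z = u₀ + D.gen h * u₁) → ∃ u₀ ∈ D.sub A U W, ∃ u₁ ∈ D.sub A U W, w * z = u₀ + D.gen h * u₁)
    ?_ ?_ ?_ ?_ ?_ hw
  · rintro s hs _ ⟨u₀, h₀, u₁, h₁, rfl⟩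
    refine ⟨_, mul_mem h₀ (scalar_mem hs), _, mul_mem h₁ (scalar_mem hs), ?_⟩
    rw [Algebra.commutes, add_mul, mul_assoc]
  · rintro i hi _ ⟨u₀, h₀, u₁, h₁, rfl⟩
    refine ⟨_, add_mem (mul_mem (lam_mem hi) h₀) (mul_mem (scalar_mem (hx i hi)) h₁), _,
      neg_mem (mul_mem (lam_mem hi) h₁), ?_⟩
    have : D.lam i * D.gen h = algebraMap S C (D.x i h) - D.gen h * D.lam i := by
      rw [D.gen_lam]; abel
    rw [mul_add, ← mul_assoc _ _ u₁, this]; noncomm_ring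
  · rintro k hk _ ⟨u₀, h₀, u₁, h₁, rfl⟩
    by_cases hkh : k = h
    · subst hkh
      exact ⟨0, zero_mem _, u₀, h₀, by rw [mul_add, ← mul_assoc _ _ u₁, D.gen_sq]; simp⟩
    · have hk : k ∈ W := by simpa [hkh] using hk
      refine ⟨_, mul_mem (gen_mem hk) h₀, _, neg_mem (mul_mem (gen_mem hk) h₁), ?_⟩
      rw [mul_add, ← mul_assoc _ _ u₁, D.gen_gen k h]; noncomm_ring
  · intro x y hx hy z hz
    obtain ⟨u₀, h₀, u₁, h₁, e⟩ := hx z hz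
    obtain ⟨v₀, k₀, v₁, k₁, e'⟩ := hy z hz
    exact ⟨_, add_mem h₀ k₀, _, add_mem h₁ k₁, by rw [add_mul, e, e']; noncomm_ring⟩
  · intro x y hx hy z hz
    rw [mul_assoc]
    exact hx _ (hy z hz)

theorem exists_gen_mul_eq {h : κ} (hx : ∀ i ∈ U, D.x i h ∈ A) {w : C}
    (hw : w ∈ D.sub A U W) :
    ∃ u₀ ∈ D.sub A U W, ∃ u₁ ∈ D.sub A U W, D.gen h * w = u₀ + u₁ * D.gen h := by
  suffices H : ∀ z, (∃ u₀ ∈ D.sub A U W, ∃ u₁ ∈ D.sub A U W, z = u₀ + u₁ * D.gen h) →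
      ∃ u₀ ∈ D.sub A U W, ∃ u₁ ∈ D.sub A U W, z * w = u₀ + u₁ * D.gen h from
    H (D.gen h) ⟨0, zero_mem _, 1, one_mem _, by simp⟩
  refine sub_induction (p := fun w => ∀ z, (∃ u₀ ∈ D.sub A U W, ∃ u₁ ∈ D.sub A U W,
      z = u₀ + u₁ * D.gen h) → ∃ u₀ ∈ D.sub A U W, ∃ u₁ ∈ D.sub A U W, z * w = u₀ + u₁ * D.gen h)
    ?_ ?_ ?_ ?_ ?_ hw
  · rintro s hs _ ⟨u₀, h₀, u₁, h₁, rfl⟩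
    refine ⟨_, mul_mem (scalar_mem hs) h₀, _, mul_mem (scalar_mem hs) h₁, ?_⟩
    rw [← Algebra.commutes, mul_add, mul_assoc]
  · rintro i hi _ ⟨u₀, h₀, u₁, h₁, rfl⟩
    refine ⟨_, add_mem (mul_mem h₀ (lam_mem hi)) (mul_mem h₁ (scalar_mem (hx i hi))), _,
      neg_mem (mul_mem h₁ (lam_mem hi)), ?_⟩
    rw [add_mul, mul_assoc u₁, D.gen_lam]; noncomm_ring
  · rintro k hk _ ⟨u₀, h₀, u₁, h₁, rfl⟩
    refine ⟨_, mul_mem h₀ (gen_mem hk), _, neg_mem (mul_mem h₁ (gen_mem hk)), ?_⟩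
    rw [add_mul, mul_assoc u₁, D.gen_gen h k]; noncomm_ring
  · intro x y hx hy z hz
    obtain ⟨u₀, h₀, u₁, h₁, e⟩ := hx z hz
    obtain ⟨v₀, k₀, v₁, k₁, e'⟩ := hy z hz
    exact ⟨_, add_mem h₀ k₀, _, add_mem h₁ k₁, by rw [mul_add, e, e']; noncomm_ring⟩
  · intro x y hx hy z hz
    rw [← mul_assoc]
    exact hy _ (hx z hz)

end decomposition

/-- The left ideal for `(a + 1, q)` with `a + q = |U| + 1` is the annihilator of the `a`-particle
states modulo `D.null U`. -/
def Faithful (A : Subring S) (U : Finset ι) (W : Finset κ) : Prop :=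
  ∀ a q, a + q = U.card + 1 → ∀ w ∈ D.sub A U W,
    (∀ K : List ι, (∀ i ∈ K, i ∈ U) → K.length = a → D.act w (D.vec K) ∈ D.null U) →
      w ∈ D.leftIdeal A U W (a + 1) q

section faithful

variable {D} {A : Subring S} {U : Finset ι} {W : Finset κ}

theorem Faithful.mem_leftIdeal_insert [DecidableEq κ] {i : ι} (hi : i ∉ U)
    (hx : ∀ k ∈ W, D.x i k ∈ A) (hP : D.Faithful A U W) {a q : ℕ} (haq : a + q = U.card + 1) {w : C}
    (hw : w ∈ D.sub A (insert i U) W)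
    (H : ∀ K : List ι, (∀ j ∈ K, j ∈ insert i U) → K.length = a →
      D.act w (D.vec K) ∈ D.null U) :
    w ∈ D.leftIdeal A (insert i U) W (a + 1) q := by
  obtain ⟨u₀, h₀, u₁, h₁, rfl⟩ := exists_eq_add_mul_lam hx hw
  have H₀ : ∀ K : List ι, (∀ j ∈ K, j ∈ U) → K.length = a → D.act u₀ (D.vec K) ∈ D.null U := by
    intro K hK hKa
    have hiK : i ∉ K := fun h => hi (hK i h)
    simpa [act_lam_vec hiK] using H K (fun j hj => Finset.mem_insert_of_mem (hK j hj)) hKa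
  have hU : U ⊆ insert i U := Finset.subset_insert i U
  refine add_mem (leftIdeal_mono le_rfl hU subset_rfl (hP a q haq u₀ h₀ H₀)) ?_
  obtain _ | a := a
  · simpa [lamProd] using mul_lamProd_mem (q := q) (sub_mono le_rfl hU subset_rfl h₁)
      (l := [i]) (by simp)
  · refine mul_lam_mem_leftIdeal (Finset.mem_insert_self i U) hx
      (leftIdeal_mono le_rfl hU subset_rfl (hP a (q + 1) (by omega) u₁ h₁ fun K hK hKa => ?_))
    have hiK : i ∉ K := fun h => hi (hK i h)
    have h2 := H (i :: K) (by simpa using fun j hj => Or.inr (hK j hj)) (by simpa using hKa)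
    rw [map_add, map_mul, LinearMap.add_apply, Module.End.mul_apply, act_lam_vec_cons hiK] at h2
    have h3 : D.act u₀ (D.vec (i :: K)) ∈ D.null U := by
      change D.act u₀ (D.e i (D.vec K)) ∈ _
      rw [act_e hi h₀]
      exact e_mem_null_of_notMem hi _
    exact (Submodule.add_mem_iff_right _ h3).1 h2

theorem cov_nil_act_vec_nil {s : S} {z : C} (hz : z ∈ D.leftIdeal A ∅ W 1 1)
    (h : D.act (algebraMap S C s + z) (D.vec []) ∈ D.null ∅) : s = 0 := by
  have h1 := act_vec_mem_null_of_mem_leftIdeal (a := 0) (by simp) hz (K := []) rfl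
  rw [map_add, LinearMap.add_apply, Submodule.add_mem_iff_left _ h1] at h
  simpa [cov, vec, D.cov₀_vac, Module.algebraMap_end_apply] using h [] (by simp)

theorem exists_eq_scalar_add {w : C} (hw : w ∈ D.sub A ∅ W) :
    ∃ s ∈ A, ∃ z ∈ D.leftIdeal A ∅ W 1 1, w = algebraMap S C s + z := by
  suffices h : w ∈ D.sub A ∅ W ∧ ∃ s ∈ A, ∃ z ∈ D.leftIdeal A ∅ W 1 1, w = algebraMap S C s + z
    from h.2
  refine sub_induction (p := fun w => w ∈ D.sub A ∅ W ∧ ∃ s ∈ A, ∃ z ∈ D.leftIdeal A ∅ W 1 1,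
    w = algebraMap S C s + z) (fun s hs => ?_) (fun i hi => by simp at hi) (fun k hk => ?_) ?_ ?_ hw
  · exact ⟨scalar_mem hs, s, hs, 0, zero_mem _, by simp⟩
  · refine ⟨gen_mem hk, 0, zero_mem _, D.gen k, ?_, by simp⟩
    simpa [genProd] using mul_genProd_mem (D := D) (A := A) (U := ∅) (p := 1) (one_mem _) (l := [k])
      (by simpa using hk)
  · rintro x y ⟨hx, s, hs, z, hz, rfl⟩ ⟨hy, t, ht, z', hz', rfl⟩
    exact ⟨add_mem hx hy, _, add_mem hs ht, _, add_mem hz hz', by rw [map_add]; abel⟩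
  · rintro x y ⟨hx, s, hs, z, hz, rfl⟩ ⟨hy, t, ht, z', hz', rfl⟩
    refine ⟨mul_mem hx hy, _, mul_mem hs ht, _,
      add_mem (mul_mem_leftIdeal (scalar_mem ht) hz) (mul_mem_leftIdeal hx hz'), ?_⟩
    rw [mul_add, add_mul, map_mul, add_assoc, Algebra.commutes t z]

theorem faithful_empty_left : D.Faithful A ∅ W := by
  intro a q haq w hw H
  obtain rfl | rfl : q = 0 ∨ q = 1 := by simp at haq; omega
  · exact mem_leftIdeal_zero_right hw
  · obtain rfl : a = 0 := by simpa using haq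
    obtain ⟨s, hs, z, hz, rfl⟩ := exists_eq_scalar_add hw
    rw [cov_nil_act_vec_nil hz (H [] (by simp) rfl)]
    simpa using hz

theorem eq_zero_of_act_mem_null [DecidableEq κ] (U : Finset ι) : ∀ w ∈ D.sub A U (∅ : Finset κ),
    (∀ K : List ι, (∀ i ∈ K, i ∈ U) → K.length = U.card → D.act w (D.vec K) ∈ D.null U) →
      w = 0 := by
  induction U using Finset.induction with
  | empty =>
    intro w hw H
    obtain ⟨s, hs, z, hz, rfl⟩ := exists_eq_scalar_add hw
    have hz0 : z = 0 := by
      refine leftIdeal_induction (P := fun z => z = 0) (fun u _ l hl hlU => ?_)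
        (fun u _ l hl hlU => ?_) (fun x y hx hy => by simp [hx, hy]) (by simp) hz
      all_goals
        obtain _ | ⟨k, l⟩ := l
        · simp at hl
        · simpa using hlU k (by simp)
    rw [cov_nil_act_vec_nil hz (H [] (by simp) rfl), hz0]; simp
  | insert i U hi ih =>
    intro w hw H
    obtain ⟨u₀, h₀, u₁, h₁, rfl⟩ := exists_eq_add_mul_lam (by simp) hw
    have hc := Finset.card_insert_of_notMem hi
    have hsub := Finset.subset_insert i U
    have he : ∀ K : List ι, D.act u₀ (D.vec (i :: K)) = D.e i (D.act (D.inv u₀) (D.vec K)) :=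
      fun K => act_e hi h₀ _
    obtain rfl : u₁ = 0 := by
      refine ih u₁ h₁ fun K hK hKa => ?_
      have hiK : i ∉ K := fun h => hi (hK i h)
      have h2 := null_anti hsub (H (i :: K) (by simpa using fun j hj => Or.inr (hK j hj))
        (by simp [hKa, hc]))
      rw [map_add, map_mul, LinearMap.add_apply, Module.End.mul_apply, act_lam_vec_cons hiK, he] at h2
      exact (Submodule.add_mem_iff_right _ (e_mem_null_of_notMem hi _)).1 h2
    have h4 : D.inv u₀ = 0 := by
      refine ih _ (inv_mem h₀) fun K hK hKa => ?_
      have h2 := act_lam_mem_null (Finset.mem_insert_self i U)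
        (H (i :: K) (by simpa using fun j hj => Or.inr (hK j hj)) (by simp [hKa, hc]))
      rw [zero_mul, add_zero, he, D.act_lam_e, if_pos rfl] at h2
      replace h2 := null_anti hsub h2
      exact (Submodule.sub_mem_iff_left _ (e_mem_null_of_notMem hi _)).1 h2
    have h5 := D.inv_inv u₀
    rw [h4, map_zero] at h5
    simp [← h5]

theorem faithful_empty_right [DecidableEq κ] (U : Finset ι) : D.Faithful A U (∅ : Finset κ) := by
  induction U using Finset.induction with
  | empty => exact faithful_empty_left
  | insert i U hi ih =>
    intro a q haq w hw H
    have hc := Finset.card_insert_of_notMem hi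
    obtain _ | _ | q := q
    · exact mem_leftIdeal_zero_right hw
    · rw [eq_zero_of_act_mem_null _ w hw fun K hK hKa => H K hK (by omega)]
      exact zero_mem _
    · exact leftIdeal_empty_gen_le _ (ih.mem_leftIdeal_insert hi (by simp) (q := q + 1) (by omega)
        hw fun K hK hKa => null_anti (Finset.subset_insert i U) (H K hK hKa))

end faithful

section adjoin

variable {D} {A B : Subring S} {U : Finset ι} {W : Finset κ}

theorem cov_e_mem (j : ι) {v : V} (hv : ∀ L, D.cov L v ∈ B) (L : List ι) :
    D.cov L (D.e j v) ∈ B := by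
  induction L generalizing v with
  | nil => exact D.cov₀_e j v ▸ B.zero_mem
  | cons l L ih =>
    change D.cov L (D.act (D.lam l) (D.e j v)) ∈ B
    rw [D.act_lam_e, map_sub]
    refine sub_mem ?_ (ih fun L' => hv (l :: L'))
    split_ifs
    exacts [hv L, by simp]

theorem cov_vec_mem (K L : List ι) : D.cov L (D.vec K) ∈ B := by
  induction K generalizing L with
  | nil =>
    cases L with
    | nil => simp [cov, vec, D.cov₀_vac]
    | cons l L => simp [cov, vec, D.act_lam_vac]
  | cons j K ih => exact cov_e_mem j ih L

theorem cov_act_mem (hx : ∀ j, ∀ k ∈ W, D.x j k ∈ B) {w : C} (hw : w ∈ D.sub B U W) {v : V}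
    (hv : ∀ L, D.cov L v ∈ B) (L : List ι) : D.cov L (D.act w v) ∈ B := by
  refine sub_induction (p := fun w => ∀ v, (∀ L, D.cov L v ∈ B) → ∀ L, D.cov L (D.act w v) ∈ B)
    (fun s hs v hv L => ?_) (fun i _ v hv L => hv (i :: L)) (fun k hk v hv L => ?_)
    (fun x y hx hy v hv L => ?_) (fun x y hx hy v hv L => ?_) hw v hv L
  · simpa [Module.algebraMap_end_apply] using mul_mem hs (hv L)
  · rw [D.act_gen, map_sum]
    refine sum_mem fun j _ => ?_
    simpa using mul_mem (hx j k hk) (cov_e_mem j hv L)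
  · simpa using add_mem (hx v hv L) (hy v hv L)
  · simpa using hx _ (hy v hv) L

theorem exists_eq_sum_pow_mul {y : S} (hA : (A : Set S) ⊆ Subring.closure (B ∪ {y})) {w : C}
    (hw : w ∈ D.sub A U W) :
    ∃ (N : ℕ) (b : ℕ → C), (∀ r, b r ∈ D.sub B U W) ∧ (∀ r, N ≤ r → b r = 0) ∧
      ∀ M, N ≤ M → w = ∑ r ∈ Finset.range M, b r * algebraMap S C y ^ r := by
  let f : Polynomial (D.sub B U W) →+* C := Polynomial.eval₂RingHom' (D.sub B U W).subtype
    (algebraMap S C y) fun a => (Algebra.commutes y (a : C)).symm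
  have hC : ∀ z (hz : z ∈ D.sub B U W), z ∈ f.range := fun z hz =>
    ⟨Polynomial.C ⟨z, hz⟩, Polynomial.eval₂_C _ _⟩
  have hle : D.sub A U W ≤ f.range := by
    refine Subring.closure_le.2 ?_
    rintro _ ((⟨s, hs, rfl⟩ | ⟨i, hi, rfl⟩) | ⟨k, hk, rfl⟩)
    · have : Subring.closure (B ∪ {y}) ≤ f.range.comap (algebraMap S C) := by
        refine Subring.closure_le.2 ?_
        rintro s (hs | rfl)
        · exact hC _ (scalar_mem hs)
        · exact ⟨Polynomial.X, Polynomial.eval₂_X _ _⟩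
      exact this (hA hs)
    · exact hC _ (lam_mem hi)
    · exact hC _ (gen_mem hk)
  obtain ⟨p, rfl⟩ := hle hw
  refine ⟨p.natDegree + 1, fun r => (p.coeff r : C), fun r => (p.coeff r).2, fun r hr => ?_,
    fun M hM => ?_⟩
  · simp [Polynomial.coeff_eq_zero_of_natDegree_lt hr]
  · exact Polynomial.eval₂_eq_sum_range' _ hM _

/-- Comparison of coefficients of powers of `x i h`. -/
theorem cov_coeff_eq_zero {i : ι} {h : κ}
    (hxW : ∀ j, ∀ k ∈ W, D.x j k ∈ B) (hxh : ∀ j, j ≠ i → D.x j h ∈ B)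
    (hy : ∀ (N : ℕ) (a : ℕ → S), (∀ r, a r ∈ B) →
      ∑ r ∈ Finset.range N, a r * D.x i h ^ r = 0 → ∀ r < N, a r = 0)
    {w₀ : C} {N d : ℕ} {b c : ℕ → C} (hb : ∀ r, b r ∈ D.sub B U W) (hc : ∀ r, c r ∈ D.sub B U W)
    (hcd : ∀ r, d ≤ r → c r = 0)
    (hw₀ : ∀ M, N ≤ M → w₀ = ∑ r ∈ Finset.range M, b r * algebraMap S C (D.x i h) ^ r)
    {K L : List ι}
    (H : D.cov L (D.act (w₀ + D.gen h *
      ∑ r ∈ Finset.range d, c r * algebraMap S C (D.x i h) ^ r) (D.vec K)) = 0) (s : ℕ) :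
    D.cov L (D.act (b s) (D.vec K))
      + ∑ j ∈ Finset.univ.erase i, D.x j h * D.cov L (D.e j (D.act (c s) (D.vec K)))
      + (if s = 0 then 0 else D.cov L (D.e i (D.act (c (s - 1)) (D.vec K)))) = 0 := by
  set y := D.x i h
  set β : ℕ → S := fun r => D.cov L (D.act (b r) (D.vec K)) with hβ
  set γ : ι → ℕ → S := fun j r => D.cov L (D.e j (D.act (c r) (D.vec K))) with hγ
  have hβB : ∀ r, β r ∈ B := fun r => cov_act_mem hxW (hb r) (cov_vec_mem K) L
  have hγB : ∀ j r, γ j r ∈ B := fun j r => cov_e_mem j (cov_act_mem hxW (hc r) (cov_vec_mem K)) L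
  have hγd : ∀ j r, d ≤ r → γ j r = 0 := fun j r hr => by simp [hγ, hcd r hr]
  set M := N + d + s + 1
  have hsum : ∑ r ∈ Finset.range d, c r * algebraMap S C y ^ r
      = ∑ r ∈ Finset.range (M + 1), c r * algebraMap S C y ^ r := by
    refine Finset.sum_subset (Finset.range_mono (by omega)) fun r _ hr => ?_
    rw [hcd r (by simpa using hr), zero_mul]
  have hact : ∀ (u : C) (r : ℕ) (v : V), D.act (u * algebraMap S C y ^ r) v = y ^ r • D.act u v := by
    intro u r v
    rw [← map_pow, map_mul, AlgHom.commutes, Module.End.mul_apply, Module.algebraMap_end_apply,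
      map_smul]
  rw [hw₀ (M + 1) (by omega), hsum, map_add, LinearMap.add_apply, map_add, map_mul,
    Module.End.mul_apply, D.act_gen] at H
  simp only [map_sum, LinearMap.sum_apply, hact, map_smul, smul_eq_mul] at H
  rw [← Finset.add_sum_erase _ _ (Finset.mem_univ i)] at H
  have key := hy (M + 1) (fun s => β s + ∑ j ∈ Finset.univ.erase i, D.x j h * γ j s
      + (if s = 0 then 0 else γ i (s - 1))) (fun r => ?_) ?_ s (by omega)
  · exact key
  · refine add_mem (add_mem (hβB r) (sum_mem fun j hj => mul_mem (hxh j ?_) (hγB j r))) ?_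
    · simpa using hj
    · split_ifs
      exacts [zero_mem _, hγB i _]
  · have h1 : ∑ r ∈ Finset.range (M + 1), (if r = 0 then 0 else γ i (r - 1)) * y ^ r
        = y * ∑ r ∈ Finset.range (M + 1), y ^ r * γ i r := by
      rw [Finset.sum_range_succ', Finset.sum_range_succ _ M, hγd i M (by omega)]
      simp only [Nat.add_eq_zero_iff, one_ne_zero, and_false, if_false, Nat.add_sub_cancel,
        if_true, zero_mul, mul_zero, add_zero, Finset.mul_sum]
      exact Finset.sum_congr rfl fun r _ => by ring
    simp only [add_mul, Finset.sum_add_distrib, h1]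
    rw [← H, add_assoc, add_comm (y * _)]
    congr 1
    · exact Finset.sum_congr rfl fun r _ => mul_comm _ _
    · congr 1
      simp only [Finset.sum_mul, Finset.mul_sum]
      rw [Finset.sum_comm]
      exact Finset.sum_congr rfl fun j _ => Finset.sum_congr rfl fun r _ => by ring

theorem exists_gen_mul_sub_mem [DecidableEq κ] {h : κ} {p q : ℕ} (hx : ∀ i ∈ U, D.x i h ∈ A) {c : C}
    (hc : c ∈ D.leftIdeal A U W p q) :
    ∃ u ∈ D.sub A U W, D.gen h * c - u ∈ D.leftIdeal A U (insert h W) p (q + 1) := by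
  have hW := Finset.subset_insert h W
  refine leftIdeal_induction (P := fun c => ∃ u ∈ D.sub A U W,
    D.gen h * c - u ∈ D.leftIdeal A U (insert h W) p (q + 1))
    (fun u hu l hl hlU => ?_) (fun u hu l hl hlU => ?_) ?_ ⟨0, zero_mem _, by simp⟩ hc
  · subst hl
    refine ⟨0, zero_mem _, ?_⟩
    rw [sub_zero, ← mul_assoc]
    exact mul_lamProd_mem (mul_mem (gen_mem (Finset.mem_insert_self h W))
      (sub_mono le_rfl subset_rfl hW hu)) hlU
  · subst hl
    obtain ⟨u₀, h₀, u₁, h₁, e⟩ := exists_gen_mul_eq hx hu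
    refine ⟨u₀ * D.genProd l, mul_mem h₀ (genProd_mem hlU), ?_⟩
    have := mul_genProd_mem (p := p) (sub_mono le_rfl subset_rfl hW h₁) (l := h :: l)
      (by simpa using fun j hj => Or.inr (hlU j hj))
    rw [← mul_assoc, e]
    simpa [genProd, add_mul, mul_assoc] using this
  · rintro x y ⟨u, hu, hxu⟩ ⟨v, hv, hyv⟩
    exact ⟨u + v, add_mem hu hv, by
      rw [mul_add, add_sub_add_comm]; exact add_mem hxu hyv⟩

theorem Faithful.insert_of_adjoin [DecidableEq κ] {i : ι} {h : κ} (hiU : i ∈ U) (hBA : B ≤ A)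
    (hA : (A : Set S) ⊆ Subring.closure (B ∪ {D.x i h})) (hyA : D.x i h ∈ A)
    (hxW : ∀ j, ∀ k ∈ W, D.x j k ∈ B) (hxh : ∀ j, j ≠ i → D.x j h ∈ B)
    (hy : ∀ (N : ℕ) (a : ℕ → S), (∀ r, a r ∈ B) →
      ∑ r ∈ Finset.range N, a r * D.x i h ^ r = 0 → ∀ r < N, a r = 0)
    (hP : D.Faithful B U W) (hP' : D.Faithful B (U.erase i) W) :
    D.Faithful A U (insert h W) := by
  have hW := Finset.subset_insert h W
  have hxA : ∀ j ∈ U, D.x j h ∈ A := fun j _ => by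
    by_cases hj : j = i
    exacts [hj ▸ hyA, hBA (hxh j hj)]
  have hscal : ∀ r, algebraMap S C (D.x i h) ^ r ∈ D.sub A U (insert h W) := fun r =>
    pow_mem (scalar_mem hyA) r
  have hcomm : ∀ (u : C) r, u * algebraMap S C (D.x i h) ^ r = algebraMap S C (D.x i h) ^ r * u :=
    fun u r => by rw [← map_pow, Algebra.commutes]
  intro a q haq w hw H
  obtain _ | q := q
  · exact mem_leftIdeal_zero_right hw
  have hQ : ∀ z ∈ D.sub B U W, (∀ K : List ι, (∀ j ∈ K, j ∈ U) → K.length = a →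
      D.act z (D.vec K) ∈ D.null (U.erase i)) → z ∈ D.leftIdeal B U W (a + 1) q := by
    intro z hz hzK
    have := hP'.mem_leftIdeal_insert (Finset.notMem_erase i U) (fun k hk => hxW i k hk) (a := a)
      (q := q) (by have := Finset.card_erase_add_one hiU; omega) (w := z)
    rw [Finset.insert_erase hiU] at this
    exact this hz hzK
  suffices main : ∀ (d : ℕ) (w₀ : C) (c : ℕ → C), w₀ ∈ D.sub A U W → (∀ r, c r ∈ D.sub B U W) →
      (∀ r, d ≤ r → c r = 0) →
      (∀ K : List ι, (∀ i ∈ K, i ∈ U) → K.length = a → D.act (w₀ + D.gen h *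
        ∑ r ∈ Finset.range d, c r * algebraMap S C (D.x i h) ^ r) (D.vec K) ∈ D.null U) →
      w₀ + D.gen h * ∑ r ∈ Finset.range d, c r * algebraMap S C (D.x i h) ^ r
        ∈ D.leftIdeal A U (insert h W) (a + 1) (q + 1) by
    obtain ⟨w₀, h₀, w₁, h₁, rfl⟩ := exists_eq_add_gen_mul hxA hw
    obtain ⟨d, c, hc, hcd, e⟩ := exists_eq_sum_pow_mul hA h₁
    rw [e d le_rfl] at H ⊢
    exact main d w₀ c h₀ hc hcd H
  intro d
  induction d with
  | zero =>
    intro w₀ c hw₀ hc hcd H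
    obtain ⟨N, b, hb, -, e⟩ := exists_eq_sum_pow_mul hA hw₀
    have hbI : ∀ r, b r ∈ D.leftIdeal B U W (a + 1) (q + 1) := fun r =>
      hP a (q + 1) haq (b r) (hb r) fun K hK hKa L hL => by
        have := cov_coeff_eq_zero hxW hxh hy hb hc hcd e (H K hK hKa L hL) r
        simpa [hcd] using this
    rw [Finset.range_zero, Finset.sum_empty, mul_zero, add_zero, e N le_rfl]
    refine sum_mem fun r _ => ?_
    rw [hcomm]
    exact mul_mem_leftIdeal (hscal r) (leftIdeal_mono hBA subset_rfl hW (hbI r))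
  | succ d ih =>
    intro w₀ c hw₀ hc hcd H
    obtain ⟨N, b, hb, -, e⟩ := exists_eq_sum_pow_mul hA hw₀
    have hbc : ∀ K : List ι, (∀ i ∈ K, i ∈ U) → K.length = a →
        D.act (b (d + 1)) (D.vec K) + D.e i (D.act (c d) (D.vec K)) ∈ D.null U := by
      intro K hK hKa L hL
      have := cov_coeff_eq_zero hxW hxh hy hb hc hcd e (H K hK hKa L hL) (d + 1)
      simpa [hcd] using this
    have hanti := null_anti (D := D) (Finset.erase_subset i U)
    have hbI : b (d + 1) ∈ D.leftIdeal B U W (a + 1) q := hQ _ (hb _) fun K hK hKa =>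
      (Submodule.add_mem_iff_left _ (e_mem_null_of_notMem (Finset.notMem_erase i U) _)).1
        (hanti (hbc K hK hKa))
    have hcI' : D.lam i * b (d + 1) + c d ∈ D.leftIdeal B U W (a + 1) q := by
      refine hQ _ (add_mem (mul_mem (lam_mem hiU) (hb _)) (hc _)) fun K hK hKa => ?_
      have := act_lam_mem_null hiU (hbc K hK hKa)
      rw [map_add, D.act_lam_e, if_pos rfl, ← add_sub_assoc] at this
      have := (Submodule.sub_mem_iff_left _
        (e_mem_null_of_notMem (Finset.notMem_erase i U) _)).1 (hanti this)
      simpa using this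
    have hcI : c d ∈ D.leftIdeal B U W (a + 1) q :=
      (AddSubgroup.add_mem_cancel_left _ (mul_mem_leftIdeal (lam_mem hiU) hbI)).1 hcI'
    obtain ⟨u, hu, hcu⟩ := exists_gen_mul_sub_mem hxA
      (mul_mem_leftIdeal (pow_mem (scalar_mem hyA) d) (leftIdeal_mono hBA subset_rfl subset_rfl hcI))
    set c' : ℕ → C := fun r => if r < d then c r else 0 with hc'
    have hsum : ∑ r ∈ Finset.range d, c' r * algebraMap S C (D.x i h) ^ r
        = ∑ r ∈ Finset.range d, c r * algebraMap S C (D.x i h) ^ r :=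
      Finset.sum_congr rfl fun r hr => by simp [hc', Finset.mem_range.1 hr]
    have hsplit : w₀ + D.gen h * ∑ r ∈ Finset.range (d + 1), c r * algebraMap S C (D.x i h) ^ r
        = ((w₀ + u) + D.gen h * ∑ r ∈ Finset.range d, c' r * algebraMap S C (D.x i h) ^ r)
          + (D.gen h * (algebraMap S C (D.x i h) ^ d * c d) - u) := by
      rw [hsum, Finset.sum_range_succ, hcomm (c d)]; noncomm_ring
    rw [hsplit] at H ⊢
    refine add_mem (ih _ c' (add_mem hw₀ hu) (fun r => ?_) (fun r hr => ?_) fun K hK hKa => ?_) hcu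
    · rw [hc']; dsimp only; split_ifs
      exacts [hc r, zero_mem _]
    · exact if_neg (by omega)
    · have := H K hK hKa
      rw [map_add, LinearMap.add_apply, Submodule.add_mem_iff_left] at this
      · exact this
      · exact act_vec_mem_null_of_mem_leftIdeal (by omega) hcu hKa

end adjoin

section generic

theorem supported_subset_closure {σ k : Type*} [Field k] (T : Set σ) (p : σ) :
    ((MvPolynomial.supported k T).toSubring : Set (MvPolynomial σ k)) ⊆
      Subring.closure (((MvPolynomial.supported k (T \ {p})).toSubring : Set (MvPolynomial σ k)) ∪
        {MvPolynomial.X p}) := by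
  intro s hs
  replace hs : s ∈ Algebra.adjoin k (MvPolynomial.X '' T) := hs
  induction hs using Algebra.adjoin_induction with
  | mem s hs =>
    obtain ⟨t, ht, rfl⟩ := hs
    by_cases htp : t = p
    · exact Subring.subset_closure (.inr (by rw [htp]; rfl))
    · exact Subring.subset_closure (.inl (MvPolynomial.X_mem_supported.2 ⟨ht, htp⟩))
  | algebraMap r => exact Subring.subset_closure (.inl (Subalgebra.algebraMap_mem _ r))
  | add x y _ _ hx hy => exact add_mem hx hy
  | mul x y _ _ hx hy => exact mul_mem hx hy

variable {k : Type*} [Field k] [Algebra (MvPolynomial (ι × κ) k) C]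
    [Module (MvPolynomial (ι × κ) k) V] {D : FockSystem (MvPolynomial (ι × κ) k) C V ι κ}

theorem faithful_supported [DecidableEq κ] (hD : ∀ i h, D.x i h = MvPolynomial.X (i, h))
    (W : Finset κ) :
    ∀ (T : Set (ι × κ)), (∀ i, ∀ h ∈ W, (i, h) ∈ T) → ∀ U : Finset ι,
      D.Faithful (MvPolynomial.supported k T).toSubring U W := by
  induction W using Finset.induction with
  | empty => exact fun _ _ U => faithful_empty_right U
  | insert h W hW ih =>
    intro T hT U
    obtain rfl | ⟨i, hi⟩ := U.eq_empty_or_nonempty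
    · exact faithful_empty_left
    have hX : ∀ {p : ι × κ} {T' : Set (ι × κ)}, p ∈ T' →
        (MvPolynomial.X p : MvPolynomial (ι × κ) k) ∈ MvPolynomial.supported k T' :=
      fun hp => MvPolynomial.X_mem_supported.2 hp
    have hTW : ∀ j, ∀ l ∈ W, (j, l) ∈ T \ {(i, h)} := fun j l hl =>
      ⟨hT j l (Finset.mem_insert_of_mem hl), fun e => hW ((show l = h from (Prod.ext_iff.1 e).2) ▸ hl)⟩
    refine Faithful.insert_of_adjoin (i := i) (h := h)
      (B := (MvPolynomial.supported k (T \ {(i, h)})).toSubring) hi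
      (MvPolynomial.supported_mono Set.sdiff_subset) ?_ ?_ (fun j l hl => ?_) (fun j hj => ?_) ?_
      (ih _ hTW U) (ih _ hTW _)
    · rw [hD]; exact supported_subset_closure T (i, h)
    · rw [hD]; exact hX (hT i h (Finset.mem_insert_self h W))
    · rw [hD]; exact hX (hTW j l hl)
    · rw [hD]
      exact hX ⟨hT j h (Finset.mem_insert_self h W), fun e => hj (Prod.ext_iff.1 e).1⟩
    · intro N a ha hsum r hr
      have htr := MvPolynomial.transcendental_supported_X (R := k) (i := (i, h))
        (s := T \ {(i, h)}) (by simp)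
      let p : Polynomial (MvPolynomial.supported k (T \ {(i, h)})) :=
        ∑ r ∈ Finset.range N, Polynomial.monomial r ⟨a r, ha r⟩
      have hp : p = 0 := by
        by_contra hp
        refine htr ⟨p, hp, ?_⟩
        rw [← hsum, hD, map_sum]
        exact Finset.sum_congr rfl fun r _ => by
          rw [Polynomial.aeval_monomial]; rfl
      have hc : p.coeff r = ⟨a r, ha r⟩ := by
        simp [p, Polynomial.coeff_monomial, hr]
      rw [hp] at hc
      exact (congrArg Subtype.val hc).symm

theorem faithful_top [DecidableEq κ] (hD : ∀ i h, D.x i h = MvPolynomial.X (i, h))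
    (U : Finset ι) (W : Finset κ) : D.Faithful ⊤ U W := by
  have := faithful_supported hD W Set.univ (fun _ _ _ => trivial) U
  rwa [MvPolynomial.supported_univ] at this

end generic

section lists

variable {D}

theorem vec_perm {K L : List ι} (h : K.Perm L) : D.vec K = D.vec L ∨ D.vec K = -D.vec L := by
  induction h with
  | nil => exact .inl rfl
  | cons i _ ih =>
    simp only [vec]
    rcases ih with h | h
    · exact .inl (by rw [h])
    · exact .inr (by rw [h, map_neg])
  | swap i j l => exact .inr (D.e_e _ _ _)
  | trans _ _ h₁ h₂ =>
    rcases h₁ with h₁ | h₁ <;> rcases h₂ with h₂ | h₂ <;> simp [h₁, h₂]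

theorem act_lamProd_reverse_vec {K : List ι} (hK : K.Nodup) :
    D.act (D.lamProd K.reverse) (D.vec K) = D.vac := by
  induction K with
  | nil => simp [lamProd, vec]
  | cons i K ih =>
    rw [List.nodup_cons] at hK
    have : D.lamProd (i :: K).reverse = D.lamProd K.reverse * D.lam i := by simp [lamProd]
    rw [this, map_mul, Module.End.mul_apply, act_lam_vec_cons hK.1, ih hK.2]

theorem act_lam_act_lamProd {i : ι} {v : V} (hv : D.act (D.lam i) v = 0) (l : List ι) :
    D.act (D.lam i) (D.act (D.lamProd l) v) = 0 := by
  induction l with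
  | nil => simpa [lamProd] using hv
  | cons j l ih =>
    have : D.lamProd (j :: l) = D.lam j * D.lamProd l := by simp [lamProd]
    rw [this, ← Module.End.mul_apply, ← map_mul, ← mul_assoc, D.lam_lam, neg_mul, mul_assoc]
    simp [ih]

theorem act_lamProd_eq_zero_of_mem {i : ι} {v : V} (hv : D.act (D.lam i) v = 0) {l : List ι}
    (hi : i ∈ l) : D.act (D.lamProd l) v = 0 := by
  induction l with
  | nil => simp at hi
  | cons j l ih =>
    have : D.lamProd (j :: l) = D.lam j * D.lamProd l := by simp [lamProd]
    rw [this, map_mul, Module.End.mul_apply]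
    rcases List.mem_cons.1 hi with rfl | hi
    · exact act_lam_act_lamProd hv l
    · rw [ih hi, map_zero]

end lists

end FockSystem

section clifford

variable {K m n}

theorem qφ_apply (p : Module.Dual (detS K m n) (Fin m → detS K m n) × (Fin n → detS K m n)) :
    qφ K m n p = p.1 (genφ K m n p.2) := rfl

theorem polar_qφ (p p' : Module.Dual (detS K m n) (Fin m → detS K m n) × (Fin n → detS K m n)) :
    QuadraticMap.polar (qφ K m n) p p' = p.1 (genφ K m n p'.2) + p'.1 (genφ K m n p.2) := by
  simp only [QuadraticMap.polar, qφ_apply, Prod.fst_add, Prod.snd_add, map_add,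
    LinearMap.add_apply]
  ring

/-- The inclusion of `(S^m)^∨` in the Clifford algebra. -/
def ιLam (K : Type) [Field K] (m n : ℕ) : Module.Dual (detS K m n) (Fin m → detS K m n)
    →ₗ[detS K m n] CliffordAlgebra (qφ K m n) :=
  (CliffordAlgebra.ι (qφ K m n)).comp (LinearMap.inl _ _ _)

/-- The inclusion of `S^n` in the Clifford algebra. -/
def ιG (K : Type) [Field K] (m n : ℕ) : (Fin n → detS K m n)
    →ₗ[detS K m n] CliffordAlgebra (qφ K m n) :=
  (CliffordAlgebra.ι (qφ K m n)).comp (LinearMap.inr _ _ _)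

theorem ι_eq_add (p : Module.Dual (detS K m n) (Fin m → detS K m n) × (Fin n → detS K m n)) :
    CliffordAlgebra.ι (qφ K m n) p = ιLam K m n p.1 + ιG K m n p.2 := by
  change _ = CliffordAlgebra.ι (qφ K m n) (p.1, 0) + CliffordAlgebra.ι (qφ K m n) (0, p.2)
  rw [← map_add]; simp

theorem ιLam_mul_ιLam_add_swap (d d' : Module.Dual (detS K m n) (Fin m → detS K m n)) :
    ιLam K m n d * ιLam K m n d' + ιLam K m n d' * ιLam K m n d = 0 := by
  refine (CliffordAlgebra.ι_mul_ι_add_swap _ _).trans ?_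
  simp [polar_qφ]

theorem ιG_mul_ιG_add_swap (g g' : Fin n → detS K m n) :
    ιG K m n g * ιG K m n g' + ιG K m n g' * ιG K m n g = 0 := by
  refine (CliffordAlgebra.ι_mul_ι_add_swap _ _).trans ?_
  simp [polar_qφ]

theorem ιG_mul_ιLam_add_swap (d : Module.Dual (detS K m n) (Fin m → detS K m n))
    (g : Fin n → detS K m n) :
    ιG K m n g * ιLam K m n d + ιLam K m n d * ιG K m n g = algebraMap _ _ (d (genφ K m n g)) := by
  refine (CliffordAlgebra.ι_mul_ι_add_swap _ _).trans ?_
  simp [polar_qφ]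

theorem ιLam_mul_self (d : Module.Dual (detS K m n) (Fin m → detS K m n)) :
    ιLam K m n d * ιLam K m n d = 0 := by
  refine (CliffordAlgebra.ι_sq_scalar _ _).trans ?_
  simp [qφ_apply]

theorem ιG_mul_self (g : Fin n → detS K m n) : ιG K m n g * ιG K m n g = 0 := by
  refine (CliffordAlgebra.ι_sq_scalar _ _).trans ?_
  simp [qφ_apply]

/-- The generators of the Clifford algebra acting on `Λ S^m`. -/
def fockGen (K : Type) [Field K] (m n : ℕ) :
    (Module.Dual (detS K m n) (Fin m → detS K m n) × (Fin n → detS K m n)) →ₗ[detS K m n]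
      Module.End (detS K m n) (ExteriorAlgebra (detS K m n) (Fin m → detS K m n)) :=
  LinearMap.coprod
    (CliffordAlgebra.contractLeft (Q := (0 : QuadraticForm (detS K m n) (Fin m → detS K m n))))
    ((LinearMap.mul (detS K m n) (ExteriorAlgebra (detS K m n) (Fin m → detS K m n))).comp
      ((ExteriorAlgebra.ι (detS K m n)).comp (genφ K m n)))

theorem fockGen_apply (p : Module.Dual (detS K m n) (Fin m → detS K m n) × (Fin n → detS K m n))
    (v : ExteriorAlgebra (detS K m n) (Fin m → detS K m n)) :
    fockGen K m n p v = ctr K m n p.1 v + ExteriorAlgebra.ι (detS K m n) (genφ K m n p.2) * v :=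
  rfl

theorem ctr_ι_mul (d : Module.Dual (detS K m n) (Fin m → detS K m n)) (a : Fin m → detS K m n)
    (v : ExteriorAlgebra (detS K m n) (Fin m → detS K m n)) :
    ctr K m n d (ExteriorAlgebra.ι (detS K m n) a * v)
      = d a • v - ExteriorAlgebra.ι (detS K m n) a * ctr K m n d v :=
  CliffordAlgebra.contractLeft_ι_mul _ _ _

/-- The Clifford action on `Λ S^m`. -/
def fockAct (K : Type) [Field K] (m n : ℕ) : CliffordAlgebra (qφ K m n) →ₐ[detS K m n]
    Module.End (detS K m n) (ExteriorAlgebra (detS K m n) (Fin m → detS K m n)) :=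
  CliffordAlgebra.lift (qφ K m n) ⟨fockGen K m n, fun p => by
    refine LinearMap.ext fun v => ?_
    rw [Module.End.mul_apply, Module.algebraMap_end_apply, qφ_apply]
    have h : ctr K m n p.1 (ctr K m n p.1 v) = 0 := CliffordAlgebra.contractLeft_contractLeft _ _
    simp only [fockGen_apply, map_add, h, ctr_ι_mul]
    rw [← mul_assoc, ExteriorAlgebra.ι_sq_zero, zero_mul]
    abel⟩

theorem fockAct_ιLam (d : Module.Dual (detS K m n) (Fin m → detS K m n))
    (v : ExteriorAlgebra (detS K m n) (Fin m → detS K m n)) :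
    fockAct K m n (ιLam K m n d) v = ctr K m n d v := by
  change fockAct K m n (CliffordAlgebra.ι (qφ K m n) (d, 0)) v = _
  rw [fockAct, CliffordAlgebra.lift_ι_apply, fockGen_apply]; simp

theorem fockAct_ιG (g : Fin n → detS K m n)
    (v : ExteriorAlgebra (detS K m n) (Fin m → detS K m n)) :
    fockAct K m n (ιG K m n g) v = ExteriorAlgebra.ι (detS K m n) (genφ K m n g) * v := by
  change fockAct K m n (CliffordAlgebra.ι (qφ K m n) (0, g)) v = _
  rw [fockAct, CliffordAlgebra.lift_ι_apply, fockGen_apply]; simp [ctr]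

/-- The Fock system given by the Clifford algebra of `q_φ` acting on `Λ S^m`. -/
def cliffFock (K : Type) [Field K] (m n : ℕ) : FockSystem (detS K m n) (CliffordAlgebra (qφ K m n))
    (ExteriorAlgebra (detS K m n) (Fin m → detS K m n)) (Fin m) (Fin n) where
  x i k := MvPolynomial.X (i, k)
  lam i := ιLam K m n (LinearMap.proj i)
  gen k := ιG K m n (Pi.single k 1)
  inv := CliffordAlgebra.involute
  act := fockAct K m n
  e i := LinearMap.mulLeft _ (ExteriorAlgebra.ι _ (Pi.single i 1))
  vac := 1
  cov₀ := ExteriorAlgebra.algebraMapInv.toLinearMap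
  lam_sq i := ιLam_mul_self _
  lam_lam i j := eq_neg_of_add_eq_zero_left (ιLam_mul_ιLam_add_swap _ _)
  gen_sq i := ιG_mul_self _
  gen_gen i j := eq_neg_of_add_eq_zero_left (ιG_mul_ιG_add_swap _ _)
  gen_lam i k := by
    rw [eq_sub_iff_add_eq, ιG_mul_ιLam_add_swap]
    simp [genφ, genX]
  inv_lam i := CliffordAlgebra.involute_ι _
  inv_gen i := CliffordAlgebra.involute_ι _
  inv_inv w := CliffordAlgebra.involute_involute w
  e_sq i v := by simp [← mul_assoc]
  e_e i j v := by
    rw [eq_neg_iff_add_eq_zero]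
    simp only [LinearMap.mulLeft_apply, ← mul_assoc, ← add_mul]
    rw [ExteriorAlgebra.ι_add_mul_swap, zero_mul]
  act_lam_e i j v := by
    simp [fockAct_ιLam, ctr_ι_mul, Pi.single_apply]
  act_gen k v := by
    have : genφ K m n (Pi.single k 1) = ∑ i, (MvPolynomial.X (i, k) : detS K m n) •
        (Pi.single i 1 : Fin m → detS K m n) := by
      ext i : 1
      simp [genφ, genX, Finset.sum_apply, Pi.single_apply]
    rw [fockAct_ιG, this]
    simp [Finset.sum_mul]
  cov₀_vac := map_one ExteriorAlgebra.algebraMapInv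
  cov₀_e i v := by
    simp [ExteriorAlgebra.algebraMapInv]
  act_lam_vac i := by
    rw [fockAct_ιLam]
    exact CliffordAlgebra.contractLeft_one (Q := (0 : QuadraticForm _ (Fin m → detS K m n))) _

theorem mem_cliffFock_sub (w : CliffordAlgebra (qφ K m n)) :
    w ∈ (cliffFock K m n).sub ⊤ Finset.univ Finset.univ := by
  induction w using CliffordAlgebra.induction with
  | algebraMap r => exact FockSystem.scalar_mem trivial
  | ι p =>
    have h₁ : p.1 = ∑ i, p.1 (Pi.single i 1) • LinearMap.proj i := by
      refine LinearMap.pi_ext' fun i => LinearMap.ext_ring ?_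
      simp [Pi.single_apply]
    have h₂ : p.2 = ∑ k, p.2 k • (Pi.single k 1 : Fin n → detS K m n) := by
      ext i : 1
      simp [Finset.sum_apply, Pi.single_apply]
    rw [ι_eq_add, h₁, h₂, map_sum, map_sum]
    refine add_mem (sum_mem fun i _ => ?_) (sum_mem fun k _ => ?_)
    · rw [map_smul, Algebra.smul_def]
      exact mul_mem (FockSystem.scalar_mem trivial)
        (FockSystem.lam_mem (D := cliffFock K m n) (Finset.mem_univ i))
    · rw [map_smul, Algebra.smul_def]
      exact mul_mem (FockSystem.scalar_mem trivial)
        (FockSystem.gen_mem (D := cliffFock K m n) (Finset.mem_univ k))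
  | mul x y hx hy => exact mul_mem hx hy
  | add x y hx hy => exact add_mem hx hy

theorem mem_leftIdeal_of_fockAct_vec_eq_zero {a : ℕ} (ha : a ≤ m)
    {w : CliffordAlgebra (qφ K m n)}
    (H : ∀ I : List (Fin m), I.length = a → fockAct K m n w ((cliffFock K m n).vec I) = 0) :
    w ∈ (cliffFock K m n).leftIdeal ⊤ Finset.univ Finset.univ (a + 1) (m + 1 - a) := by
  refine FockSystem.faithful_top (D := cliffFock K m n) (fun _ _ => rfl) _ _ a _ ?_ w
    (mem_cliffFock_sub w) fun I _ hI => ?_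
  · rw [Finset.card_univ, Fintype.card_fin]; omega
  · have := H I hI
    change fockAct K m n w _ ∈ _
    rw [this]; exact zero_mem _

end clifford

section submodule

variable {R A M : Type*} [CommRing R] [Ring A] [Algebra R A] [AddCommGroup M] [Module R M]

theorem span_list_prod_eq_range_pow (f : M →ₗ[R] A) (p : ℕ) :
    Submodule.span R {x | ∃ l : List M, l.length = p ∧ x = (l.map f).prod} =
      LinearMap.range f ^ p := by
  induction p with
  | zero =>
    rw [pow_zero, Submodule.one_eq_span]
    congr 1
    ext x
    simp
  | succ p ih =>
    rw [pow_succ', ← ih, ← Submodule.span_eq (LinearMap.range f), Submodule.span_mul_span]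
    congr 1
    ext x
    simp only [Set.mem_ofPred_eq, Set.mem_mul, SetLike.mem_coe, LinearMap.mem_range]
    constructor
    · rintro ⟨l, hl, rfl⟩
      obtain _ | ⟨v, l⟩ := l
      · simp at hl
      · exact ⟨f v, ⟨v, rfl⟩, _, ⟨l, by simpa using hl, rfl⟩, by simp⟩
    · rintro ⟨_, ⟨v, rfl⟩, _, ⟨l, hl, rfl⟩, rfl⟩
      exact ⟨v :: l, by simp [hl], by simp⟩

theorem iSup_pow_mul_iSup_pow_eq_top {P Q : Submodule R A} (h : P * Q ≤ Q * P ⊔ 1)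
    (htop : ∀ N : Submodule R A, 1 ≤ N → P * N ≤ N → Q * N ≤ N → N = ⊤) :
    (⨆ r : ℕ, Q ^ r) * (⨆ p : ℕ, P ^ p) = ⊤ := by
  set X : Submodule R A := ⨆ r : ℕ, Q ^ r
  set Y : Submodule R A := ⨆ p : ℕ, P ^ p
  have hX : ∀ r, Q ^ r ≤ X := le_iSup (fun r : ℕ => Q ^ r)
  have hY : ∀ r, P ^ r ≤ Y := le_iSup (fun r : ℕ => P ^ r)
  have hQX : Q * X ≤ X := by
    rw [Submodule.mul_iSup]
    exact iSup_le fun r => by rw [← pow_succ']; exact hX _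
  have hPY : P * Y ≤ Y := by
    rw [Submodule.mul_iSup]
    exact iSup_le fun r => by rw [← pow_succ']; exact hY _
  have hPX : P * X ≤ X * P ⊔ X := by
    rw [Submodule.mul_iSup]
    refine iSup_le fun r => ?_
    induction r with
    | zero =>
      rw [pow_zero, mul_one]
      refine le_sup_of_le_left ?_
      calc P = Q ^ 0 * P := by rw [pow_zero, one_mul]
        _ ≤ X * P := mul_le_mul_left (hX 0) P
    | succ r ih =>
      calc P * Q ^ (r + 1) = (P * Q) * Q ^ r := by rw [pow_succ', mul_assoc]
        _ ≤ (Q * P ⊔ 1) * Q ^ r := mul_le_mul_left h _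
        _ = Q * (P * Q ^ r) ⊔ Q ^ r := by rw [Submodule.sup_mul, mul_assoc, one_mul]
        _ ≤ Q * (X * P ⊔ X) ⊔ X := sup_le_sup (mul_le_mul_right ih _) (hX r)
        _ = (Q * X) * P ⊔ Q * X ⊔ X := by rw [Submodule.mul_sup, mul_assoc]
        _ ≤ X * P ⊔ X := sup_le (sup_le_sup (mul_le_mul_left hQX _) hQX) le_sup_right
  refine htop _ ?_ ?_ ?_
  · calc (1 : Submodule R A) = Q ^ 0 * P ^ 0 := by simp
      _ ≤ X * Y := mul_le_mul' (hX 0) (hY 0)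
  · calc P * (X * Y) = (P * X) * Y := (mul_assoc _ _ _).symm
      _ ≤ (X * P ⊔ X) * Y := mul_le_mul_left hPX _
      _ = X * (P * Y) ⊔ X * Y := by rw [Submodule.sup_mul, mul_assoc]
      _ ≤ X * Y := sup_le (mul_le_mul_right hPY _) le_rfl
  · rw [← mul_assoc]
    exact mul_le_mul_left hQX _

end submodule

section powers

variable {K m n}

theorem lamPow_eq (p : ℕ) : lamPow K m n p = LinearMap.range (ιLam K m n) ^ p :=
  span_list_prod_eq_range_pow (ιLam K m n) p

theorem gPow_eq (q : ℕ) : gPow K m n q = LinearMap.range (ιG K m n) ^ q :=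
  span_list_prod_eq_range_pow (ιG K m n) q

theorem eq_top_of_generators_mul_le {N : Submodule (detS K m n) (CliffordAlgebra (qφ K m n))}
    (h1 : 1 ≤ N) (hL : LinearMap.range (ιLam K m n) * N ≤ N)
    (hG : LinearMap.range (ιG K m n) * N ≤ N) : N = ⊤ := by
  refine eq_top_iff.2 fun w _ => ?_
  induction w using CliffordAlgebra.left_induction with
  | algebraMap r => exact h1 (Submodule.mem_one.2 ⟨r, rfl⟩)
  | add x y hx hy => exact add_mem (hx trivial) (hy trivial)
  | ι_mul x p hx =>
    rw [ι_eq_add, add_mul]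
    exact add_mem (hL (Submodule.mul_mem_mul ⟨_, rfl⟩ (hx trivial)))
      (hG (Submodule.mul_mem_mul ⟨_, rfl⟩ (hx trivial)))

theorem iSup_gPow_mul_iSup_lamPow :
    (⨆ r : ℕ, gPow K m n r) * (⨆ p : ℕ, lamPow K m n p) = ⊤ := by
  simp only [gPow_eq, lamPow_eq]
  refine iSup_pow_mul_iSup_pow_eq_top ?_ fun N h1 hL hG => eq_top_of_generators_mul_le h1 hL hG
  rw [Submodule.mul_le]
  rintro _ ⟨d, rfl⟩ _ ⟨g, rfl⟩
  rw [eq_sub_of_add_eq' (ιG_mul_ιLam_add_swap d g), sub_eq_add_neg, add_comm]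
  exact Submodule.add_mem_sup (neg_mem (Submodule.mul_mem_mul ⟨_, rfl⟩ ⟨_, rfl⟩))
    (Submodule.mem_one.2 ⟨_, rfl⟩)

theorem iSup_lamPow_mul_iSup_gPow :
    (⨆ p : ℕ, lamPow K m n p) * (⨆ r : ℕ, gPow K m n r) = ⊤ := by
  simp only [gPow_eq, lamPow_eq]
  refine iSup_pow_mul_iSup_pow_eq_top ?_ fun N h1 hG hL => eq_top_of_generators_mul_le h1 hL hG
  rw [Submodule.mul_le]
  rintro _ ⟨g, rfl⟩ _ ⟨d, rfl⟩
  rw [eq_sub_of_add_eq (ιG_mul_ιLam_add_swap d g), sub_eq_add_neg, add_comm]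
  exact Submodule.add_mem_sup (neg_mem (Submodule.mul_mem_mul ⟨_, rfl⟩ ⟨_, rfl⟩))
    (Submodule.mem_one.2 ⟨_, rfl⟩)

theorem leftIdeal_le_iSup_sup_iSup {a q : ℕ} {w : CliffordAlgebra (qφ K m n)}
    (hw : w ∈ (cliffFock K m n).leftIdeal ⊤ Finset.univ Finset.univ a q) :
    w ∈ (⨆ (r : ℕ) (t : ℕ), gPow K m n r * lamPow K m n (a + t)) ⊔
      (⨆ (p : ℕ) (t : ℕ), lamPow K m n p * gPow K m n (q + t)) := by
  refine FockSystem.leftIdeal_induction (P := fun w => w ∈ _) (fun u _ l hl _ => ?_)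
    (fun u _ l hl _ => ?_) (fun x y hx hy => add_mem hx hy) (zero_mem _) hw
  · refine Submodule.mem_sup_left ?_
    have h1 : u ∈ (⨆ r : ℕ, gPow K m n r) * (⨆ p : ℕ, lamPow K m n p) :=
      iSup_gPow_mul_iSup_lamPow (K := K) ▸ trivial
    have h2 : (cliffFock K m n).lamProd l ∈ lamPow K m n a :=
      Submodule.subset_span ⟨l.map LinearMap.proj, by simpa using hl, by
        rw [List.map_map]; rfl⟩
    refine (?_ : _ ≤ (_ : Submodule _ _)) (Submodule.mul_mem_mul h1 h2)
    simp only [Submodule.iSup_mul, Submodule.mul_iSup, mul_assoc]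
    refine iSup_le fun p => iSup_le fun r => le_iSup₂_of_le r p ?_
    simp only [gPow_eq, lamPow_eq, ← pow_add]
    rw [add_comm]
  · refine Submodule.mem_sup_right ?_
    have h1 : u ∈ (⨆ p : ℕ, lamPow K m n p) * (⨆ r : ℕ, gPow K m n r) :=
      iSup_lamPow_mul_iSup_gPow (K := K) ▸ trivial
    have h2 : (cliffFock K m n).genProd l ∈ gPow K m n q :=
      Submodule.subset_span ⟨l.map (fun k => Pi.single k 1), by simpa using hl, by
        rw [List.map_map]; rfl⟩
    refine (?_ : _ ≤ (_ : Submodule _ _)) (Submodule.mul_mem_mul h1 h2)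
    simp only [Submodule.iSup_mul, Submodule.mul_iSup, mul_assoc]
    refine iSup_le fun r => iSup_le fun p => le_iSup₂_of_le p r ?_
    simp only [gPow_eq, lamPow_eq, ← pow_add]
    rw [add_comm]

end powers

section degree

variable {K m n}

/-- The coaction on the Clifford algebra recording the degree. -/
def degHom (K : Type) [Field K] (m n : ℕ) : CliffordAlgebra (qφ K m n) →ₐ[detS K m n]
    AddMonoidAlgebra (CliffordAlgebra (qφ K m n)) ℤ :=
  CliffordAlgebra.lift (qφ K m n)
    ⟨LinearMap.coprod
      ((AddMonoidAlgebra.lsingle (R := detS K m n) (-1 : ℤ)).comp (ιLam K m n))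
      ((AddMonoidAlgebra.lsingle (R := detS K m n) (1 : ℤ)).comp (ιG K m n)), fun p => by
    simp only [LinearMap.coprod_apply, LinearMap.comp_apply, AddMonoidAlgebra.lsingle_apply,
      add_mul, mul_add, AddMonoidAlgebra.single_mul_single, ιLam_mul_self, ιG_mul_self,
      AddMonoidAlgebra.single_zero, AddMonoidAlgebra.coe_algebraMap, Function.comp_apply,
      qφ_apply, ← ιG_mul_ιLam_add_swap, AddMonoidAlgebra.single_add, zero_add, add_zero,
      Int.reduceNeg, neg_add_cancel, add_neg_cancel]⟩

theorem degHom_ιLam (d : Module.Dual (detS K m n) (Fin m → detS K m n)) :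
    degHom K m n (ιLam K m n d) = AddMonoidAlgebra.single (-1) (ιLam K m n d) := by
  change degHom K m n (CliffordAlgebra.ι (qφ K m n) (d, 0)) = _
  rw [degHom, CliffordAlgebra.lift_ι_apply]; simp

theorem degHom_ιG (g : Fin n → detS K m n) :
    degHom K m n (ιG K m n g) = AddMonoidAlgebra.single 1 (ιG K m n g) := by
  change degHom K m n (CliffordAlgebra.ι (qφ K m n) (0, g)) = _
  rw [degHom, CliffordAlgebra.lift_ι_apply]; simp

theorem degHom_of_mem_cliffDeg {d : ℤ} {w : CliffordAlgebra (qφ K m n)}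
    (hw : w ∈ cliffDeg K m n d) : degHom K m n w = AddMonoidAlgebra.single d w := by
  induction hw using Submodule.span_induction with
  | mem x hx =>
    obtain ⟨l, rfl, rfl⟩ := hx
    induction l with
    | nil => rw [List.map_nil, List.prod_nil, map_one]; rfl
    | cons g l ih =>
      have hg : degHom K m n (cliffGen K m n g) =
          AddMonoidAlgebra.single (genDeg K m n g) (cliffGen K m n g) := by
        obtain d | g := g
        exacts [degHom_ιLam d, degHom_ιG g]
      simp only [List.map_cons, List.prod_cons, List.sum_cons, map_mul, ih, hg,
        AddMonoidAlgebra.single_mul_single]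
  | zero => simp
  | add x y _ _ hx hy => rw [map_add, hx, hy, AddMonoidAlgebra.single_add]
  | smul c x _ hx => rw [map_smul, hx, AddMonoidAlgebra.smul_single]

/-- The projection to the degree `d` component. -/
def degProj (K : Type) [Field K] (m n : ℕ) (d : ℤ) :
    CliffordAlgebra (qφ K m n) →ₗ[detS K m n] CliffordAlgebra (qφ K m n) :=
  (Finsupp.lapply d).comp
    ((AddMonoidAlgebra.coeffLinearEquiv (detS K m n)).toLinearMap.comp (degHom K m n).toLinearMap)

theorem degProj_of_mem_cliffDeg {d d' : ℤ} {w : CliffordAlgebra (qφ K m n)}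
    (hw : w ∈ cliffDeg K m n d') : degProj K m n d w = if d' = d then w else 0 := by
  change (degHom K m n w).coeff d = _
  rw [degHom_of_mem_cliffDeg hw, AddMonoidAlgebra.coeff_single, Finsupp.single_apply]

theorem mem_of_mem_cliffDeg {d : ℤ} {w : CliffordAlgebra (qφ K m n)}
    {J T : Submodule (detS K m n) (CliffordAlgebra (qφ K m n))}
    (hJ : J ≤ T.comap (degProj K m n d)) (hw : w ∈ cliffDeg K m n d) (hwJ : w ∈ J) : w ∈ T := by
  simpa [degProj_of_mem_cliffDeg hw] using hJ hwJ

theorem le_comap_degProj {d d' : ℤ} {N T : Submodule (detS K m n) (CliffordAlgebra (qφ K m n))}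
    (hN : N ≤ cliffDeg K m n d') (hT : d' = d → N ≤ T) : N ≤ T.comap (degProj K m n d) := by
  intro w hw
  rw [Submodule.mem_comap, degProj_of_mem_cliffDeg (hN hw)]
  split_ifs with h
  · exact hT h hw
  · exact T.zero_mem

theorem cliffDeg_mul_le (d d' : ℤ) :
    cliffDeg K m n d * cliffDeg K m n d' ≤ cliffDeg K m n (d + d') := by
  rw [cliffDeg, cliffDeg, Submodule.span_mul_span]
  refine Submodule.span_mono ?_
  rintro _ ⟨_, ⟨l, rfl, rfl⟩, _, ⟨l', rfl, rfl⟩, rfl⟩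
  exact ⟨l ++ l', by simp, by simp⟩

theorem lamPow_le_cliffDeg (p : ℕ) : lamPow K m n p ≤ cliffDeg K m n (-p) := by
  refine Submodule.span_mono ?_
  rintro _ ⟨l, rfl, rfl⟩
  refine ⟨l.map Sum.inl, ?_, ?_⟩
  · rw [List.map_map]
    change (l.map fun _ => (-1 : ℤ)).sum = _
    simp
  · rw [List.map_map]; rfl

theorem gPow_le_cliffDeg (q : ℕ) : gPow K m n q ≤ cliffDeg K m n q := by
  refine Submodule.span_mono ?_
  rintro _ ⟨l, rfl, rfl⟩
  refine ⟨l.map Sum.inr, ?_, ?_⟩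
  · rw [List.map_map]
    change (l.map fun _ => (1 : ℤ)).sum = _
    simp
  · rw [List.map_map]; rfl

theorem lamPow_mul_gPow_le_cliffDeg (p q : ℕ) :
    lamPow K m n p * gPow K m n q ≤ cliffDeg K m n (-p + q) :=
  (mul_le_mul' (lamPow_le_cliffDeg p) (gPow_le_cliffDeg q)).trans (cliffDeg_mul_le _ _)

theorem gPow_mul_lamPow_le_cliffDeg (p q : ℕ) :
    gPow K m n q * lamPow K m n p ≤ cliffDeg K m n (q + -p) :=
  (mul_le_mul' (gPow_le_cliffDeg q) (lamPow_le_cliffDeg p)).trans (cliffDeg_mul_le _ _)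

end degree

section quotient

variable {K m n}

theorem rho_detπ
    (ρ : CliffordAlgebra (qφ K m n) →ₐ[detS K m n] Module.End (detS K m n) (detM K m n))
    (hρD : ∀ lam x, ρ (CliffordAlgebra.ι (qφ K m n) (lam, 0)) (detπ K m n x)
      = detπ K m n (ctr K m n lam x))
    (hρT : ∀ g x, ρ (CliffordAlgebra.ι (qφ K m n) (0, g)) (detπ K m n x)
      = detπ K m n (ExteriorAlgebra.ι (detS K m n) (genφ K m n g) * x))
    (w : CliffordAlgebra (qφ K m n)) (x : ExteriorAlgebra (detS K m n) (Fin m → detS K m n)) :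
    ρ w (detπ K m n x) = detπ K m n (fockAct K m n w x) := by
  induction w using CliffordAlgebra.induction generalizing x with
  | algebraMap r => simp
  | ι p =>
    rw [ι_eq_add]
    simp only [map_add, LinearMap.add_apply, fockAct_ιLam, fockAct_ιG, ← hρD, ← hρT]
    rfl
  | mul u v hu hv => simp only [map_mul, Module.End.mul_apply, hu, hv]
  | add u v hu hv => simp only [map_add, LinearMap.add_apply, hu, hv]

/-- The image of `Λ S^n` in the Clifford algebra. -/
def extG (K : Type) [Field K] (m n : ℕ) : ExteriorAlgebra (detS K m n) (Fin n → detS K m n)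
    →ₐ[detS K m n] CliffordAlgebra (qφ K m n) :=
  ExteriorAlgebra.lift _ ⟨ιG K m n, ιG_mul_self⟩

theorem fockAct_extG (z : ExteriorAlgebra (detS K m n) (Fin n → detS K m n))
    (v : ExteriorAlgebra (detS K m n) (Fin m → detS K m n)) :
    fockAct K m n (extG K m n z) v = ExteriorAlgebra.map (genφ K m n) z * v := by
  induction z using ExteriorAlgebra.induction generalizing v with
  | algebraMap r => simp [Algebra.smul_def]
  | ι g => simp [extG, fockAct_ιG]
  | mul u v hu hv => simp only [map_mul, Module.End.mul_apply, hu, hv, mul_assoc]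
  | add u v hu hv => simp only [map_add, LinearMap.add_apply, hu, hv, add_mul]

theorem extG_mem (z : ExteriorAlgebra (detS K m n) (Fin n → detS K m n)) :
    extG K m n z ∈ ⨆ r : ℕ, gPow K m n r := by
  have hz : z ∈ ⨆ r : ℕ, LinearMap.range (ExteriorAlgebra.ι (detS K m n)
      (M := Fin n → detS K m n)) ^ r := by
    have := (DirectSum.Decomposition.isInternal (fun r : ℕ =>
      ⋀[detS K m n]^r (Fin n → detS K m n))).submodule_iSup_eq_top
    exact this ▸ trivial
  refine (?_ : _ ≤ Submodule.comap (extG K m n).toLinearMap (⨆ r : ℕ, gPow K m n r)) hz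
  refine iSup_le fun r => ?_
  rw [← Submodule.map_le_iff_le_comap, Submodule.map_pow]
  refine le_iSup_of_le r ?_
  rw [gPow_eq, ← LinearMap.range_comp]
  refine (congrArg (· ^ r) (congrArg LinearMap.range ?_)).le
  exact LinearMap.ext fun g => by simp [extG]

end quotient

section exterior

variable {K m n}

theorem vec_mem_exteriorPower (I : List (Fin m)) :
    (cliffFock K m n).vec I ∈ ⋀[detS K m n]^I.length (Fin m → detS K m n) := by
  induction I with
  | nil => exact Submodule.one_le.1 le_rfl
  | cons i I ih =>
    rw [List.length_cons, ExteriorAlgebra.exteriorPower, pow_succ']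
    exact Submodule.mul_mem_mul ⟨_, rfl⟩ ih

theorem exteriorPower_le_span (a : ℕ) : ⋀[detS K m n]^a (Fin m → detS K m n) ≤
    Submodule.span (detS K m n) {v | ∃ I : List (Fin m), I.length = a ∧
      v = (cliffFock K m n).vec I} := by
  induction a with
  | zero =>
    rw [ExteriorAlgebra.exteriorPower, pow_zero, Submodule.one_le]
    exact Submodule.subset_span ⟨[], rfl, rfl⟩
  | succ a ih =>
    rw [ExteriorAlgebra.exteriorPower, pow_succ', Submodule.mul_le]
    rintro _ ⟨v, rfl⟩ y hy
    have hv : v = ∑ i, v i • (Pi.single i 1 : Fin m → detS K m n) := by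
      ext i : 1
      simp [Finset.sum_apply, Pi.single_apply]
    rw [hv, map_sum, Finset.sum_mul]
    refine sum_mem fun i _ => ?_
    rw [map_smul, smul_mul_assoc]
    refine Submodule.smul_mem _ _ ?_
    refine Submodule.span_induction (fun x hx => ?_) (by simp) (fun x y _ _ hx hy => ?_)
      (fun c x _ hx => ?_) (ih hy)
    · obtain ⟨I, rfl, rfl⟩ := hx
      exact Submodule.subset_span ⟨i :: I, rfl, rfl⟩
    · rw [mul_add]; exact add_mem hx hy
    · rw [mul_smul_comm]; exact Submodule.smul_mem _ _ hx

theorem eq_zero_of_mem_exteriorPower {a : ℕ} (ha : m < a)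
    {x : ExteriorAlgebra (detS K m n) (Fin m → detS K m n)}
    (hx : x ∈ ⋀[detS K m n]^a (Fin m → detS K m n)) : x = 0 := by
  have h := exteriorPower_le_span a hx
  rw [Submodule.span_eq_bot.2, Submodule.mem_bot] at h
  · exact h
  rintro _ ⟨I, rfl, rfl⟩
  refine FockSystem.vec_of_not_nodup fun hI => ?_
  have := hI.length_le_card
  simp only [Fintype.card_fin] at this
  omega

theorem fockAct_gPow_mem {q a : ℕ} {w : CliffordAlgebra (qφ K m n)} (hw : w ∈ gPow K m n q)
    {x : ExteriorAlgebra (detS K m n) (Fin m → detS K m n)}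
    (hx : x ∈ ⋀[detS K m n]^a (Fin m → detS K m n)) :
    fockAct K m n w x ∈ ⋀[detS K m n]^(q + a) (Fin m → detS K m n) := by
  induction hw using Submodule.span_induction with
  | mem w hw =>
    obtain ⟨l, rfl, rfl⟩ := hw
    induction l with
    | nil => simpa using hx
    | cons g l ih =>
      rw [List.map_cons, List.prod_cons, map_mul, Module.End.mul_apply, List.length_cons,
        add_right_comm, ExteriorAlgebra.exteriorPower, pow_succ']
      refine (congrArg (· ∈ _) (fockAct_ιG g _)).mpr ?_
      exact Submodule.mul_mem_mul ⟨_, rfl⟩ ih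
  | zero => simp
  | add u v _ _ hu hv => simpa using add_mem hu hv
  | smul c u _ hu => simpa using Submodule.smul_mem _ c hu

theorem ctr_eq_zero_of_mem_exteriorPower_zero
    (d : Module.Dual (detS K m n) (Fin m → detS K m n))
    {x : ExteriorAlgebra (detS K m n) (Fin m → detS K m n)}
    (hx : x ∈ ⋀[detS K m n]^0 (Fin m → detS K m n)) : ctr K m n d x = 0 := by
  rw [ExteriorAlgebra.exteriorPower, pow_zero] at hx
  obtain ⟨r, rfl⟩ := Submodule.mem_one.1 hx
  exact CliffordAlgebra.contractLeft_algebraMap _ _ _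

theorem ctr_mem_exteriorPower (d : Module.Dual (detS K m n) (Fin m → detS K m n)) {a : ℕ}
    {x : ExteriorAlgebra (detS K m n) (Fin m → detS K m n)}
    (hx : x ∈ ⋀[detS K m n]^(a + 1) (Fin m → detS K m n)) :
    ctr K m n d x ∈ ⋀[detS K m n]^a (Fin m → detS K m n) := by
  refine (?_ : _ ≤ Submodule.comap (ctr K m n d) _) hx
  clear hx
  induction a with
  | zero =>
    rw [ExteriorAlgebra.exteriorPower, pow_succ', Submodule.mul_le]
    rintro _ ⟨v, rfl⟩ y hy
    rw [Submodule.mem_comap, ctr_ι_mul, ctr_eq_zero_of_mem_exteriorPower_zero d hy, mul_zero, sub_zero]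
    exact Submodule.smul_mem _ _ hy
  | succ a ih =>
    rw [ExteriorAlgebra.exteriorPower, pow_succ', Submodule.mul_le]
    rintro _ ⟨v, rfl⟩ y hy
    rw [Submodule.mem_comap, ctr_ι_mul]
    refine sub_mem (Submodule.smul_mem _ _ hy) ?_
    rw [ExteriorAlgebra.exteriorPower, pow_succ']
    exact Submodule.mul_mem_mul ⟨_, rfl⟩ (ih hy)

theorem fockAct_lamPow_mem {a t : ℕ} {w : CliffordAlgebra (qφ K m n)}
    (hw : w ∈ lamPow K m n (a + t)) {x : ExteriorAlgebra (detS K m n) (Fin m → detS K m n)}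
    (hx : x ∈ ⋀[detS K m n]^a (Fin m → detS K m n)) :
    fockAct K m n w x ∈ (1 : Submodule (detS K m n) (ExteriorAlgebra (detS K m n) _)) := by
  induction hw using Submodule.span_induction with
  | mem w hw =>
    obtain ⟨l, hl, rfl⟩ := hw
    have hl' : a ≤ l.length := by omega
    clear hl
    induction l using List.reverseRecOn generalizing a x with
    | nil =>
      obtain rfl : a = 0 := by simpa using hl'
      simpa [ExteriorAlgebra.exteriorPower] using hx
    | append_singleton l d ih =>
      rw [List.map_append, List.prod_append, map_mul, Module.End.mul_apply, List.map_singleton,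
        List.prod_singleton]
      have h : fockAct K m n (CliffordAlgebra.ι (qφ K m n) (d, 0)) x = ctr K m n d x :=
        fockAct_ιLam d x
      rw [h]
      obtain _ | a := a
      · rw [ctr_eq_zero_of_mem_exteriorPower_zero d hx, map_zero]
        exact zero_mem _
      · exact ih (ctr_mem_exteriorPower d hx) (by simpa using hl')
  | zero => simp
  | add u v _ _ hu hv => simpa using add_mem hu hv
  | smul c u _ hu => simpa using Submodule.smul_mem _ c hu

theorem fockAct_gPow_mem_range {q : ℕ} {w : CliffordAlgebra (qφ K m n)} (hw : w ∈ gPow K m n q)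
    {x : ExteriorAlgebra (detS K m n) (Fin m → detS K m n)}
    (hx : x ∈ LinearMap.range (ExteriorAlgebra.map (genφ K m n)).toLinearMap) :
    fockAct K m n w x ∈ LinearMap.range (ExteriorAlgebra.map (genφ K m n)).toLinearMap := by
  induction hw using Submodule.span_induction with
  | mem w hw =>
    obtain ⟨l, -, rfl⟩ := hw
    induction l with
    | nil => simpa using hx
    | cons g l ih =>
      rw [List.map_cons, List.prod_cons, map_mul, Module.End.mul_apply]
      refine (congrArg (· ∈ _) (fockAct_ιG g _)).mpr ?_
      obtain ⟨z, hz⟩ := ih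
      exact ⟨ExteriorAlgebra.ι _ g * z, by rw [← hz]; simp⟩
  | zero => simp
  | add u v _ _ hu hv => simpa using add_mem hu hv
  | smul c u _ hu => simpa using Submodule.smul_mem _ c hu

theorem fockAct_lamPow_mul_gPow {p q a : ℕ} (hqa : m < q + a) {w : CliffordAlgebra (qφ K m n)}
    (hw : w ∈ lamPow K m n p * gPow K m n q)
    {x : ExteriorAlgebra (detS K m n) (Fin m → detS K m n)}
    (hx : x ∈ ⋀[detS K m n]^a (Fin m → detS K m n)) : fockAct K m n w x = 0 := by
  induction hw using Submodule.mul_induction_on' with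
  | mem_mul_mem u hu v hv =>
    rw [map_mul, Module.End.mul_apply,
      eq_zero_of_mem_exteriorPower hqa (fockAct_gPow_mem hv hx), map_zero]
  | add u _ v _ hu hv => rw [map_add, LinearMap.add_apply, hu, hv, add_zero]

theorem fockAct_gPow_mul_lamPow_mem_range {q a t : ℕ} {w : CliffordAlgebra (qφ K m n)}
    (hw : w ∈ gPow K m n q * lamPow K m n (a + t))
    {x : ExteriorAlgebra (detS K m n) (Fin m → detS K m n)}
    (hx : x ∈ ⋀[detS K m n]^a (Fin m → detS K m n)) :
    fockAct K m n w x ∈ LinearMap.range (ExteriorAlgebra.map (genφ K m n)).toLinearMap := by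
  induction hw using Submodule.mul_induction_on' with
  | mem_mul_mem u hu v hv =>
    rw [map_mul, Module.End.mul_apply]
    refine fockAct_gPow_mem_range hu ?_
    obtain ⟨r, hr⟩ := Submodule.mem_one.1 (fockAct_lamPow_mem hv hx)
    exact ⟨algebraMap _ _ r, by rw [← hr]; simp⟩
  | add u _ v _ hu hv => rw [map_add, LinearMap.add_apply]; exact add_mem hu hv

end exterior

section kernel

variable {K m n}

/-- An element of the Clifford algebra sending every `vec I`, `|I| = a`, into the image of
`Λ S^n` agrees on these vectors with a combination of terms `g * lam` with `a`-fold products of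
`lam`s. -/
theorem exists_fockAct_vec_eq {a : ℕ} {w : CliffordAlgebra (qφ K m n)}
    (H : ∀ I : List (Fin m), I.length = a → fockAct K m n w ((cliffFock K m n).vec I) ∈
      LinearMap.range (ExteriorAlgebra.map (genφ K m n)).toLinearMap) :
    ∃ u ∈ (⨆ r : ℕ, gPow K m n r) * lamPow K m n a, ∀ I : List (Fin m), I.length = a →
      fockAct K m n u ((cliffFock K m n).vec I) = fockAct K m n w ((cliffFock K m n).vec I) := by
  have H' : ∀ I : Finset (Fin m), ∃ z : ExteriorAlgebra (detS K m n) (Fin n → detS K m n),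
      I.card = a → ExteriorAlgebra.map (genφ K m n) z =
        fockAct K m n w ((cliffFock K m n).vec I.toList) := fun I => by
    by_cases hI : I.card = a
    · obtain ⟨z, hz⟩ := H I.toList (by simpa using hI)
      exact ⟨z, fun _ => hz⟩
    · exact ⟨0, fun h => absurd h hI⟩
  choose z hz using H'
  refine ⟨∑ I ∈ Finset.powersetCard a Finset.univ,
    extG K m n (z I) * (cliffFock K m n).lamProd I.toList.reverse, sum_mem fun I hI => ?_,
    fun L hL => ?_⟩
  · refine Submodule.mul_mem_mul (extG_mem _) (Submodule.subset_span
      ⟨I.toList.reverse.map LinearMap.proj, ?_, ?_⟩)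
    · simpa using (Finset.mem_powersetCard.1 hI).2
    · rw [List.map_map]; rfl
  · have key : ∀ J : Finset (Fin m), J.card = a →
        fockAct K m n (∑ I ∈ Finset.powersetCard a Finset.univ,
          extG K m n (z I) * (cliffFock K m n).lamProd I.toList.reverse)
            ((cliffFock K m n).vec J.toList) =
        fockAct K m n w ((cliffFock K m n).vec J.toList) := by
      intro J hJ
      rw [map_sum, LinearMap.sum_apply, Finset.sum_eq_single J]
      · have h : fockAct K m n ((cliffFock K m n).lamProd J.toList.reverse)
            ((cliffFock K m n).vec J.toList) = 1 :=
          FockSystem.act_lamProd_reverse_vec (D := cliffFock K m n) J.nodup_toList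
        rw [map_mul, Module.End.mul_apply, h, fockAct_extG, mul_one, hz J hJ]
      · intro I hI hIJ
        have hIc := (Finset.mem_powersetCard.1 hI).2
        obtain ⟨i, hiI, hiJ⟩ : ∃ i ∈ I, i ∉ J := by
          by_contra! h
          exact hIJ (Finset.eq_of_subset_of_card_le h (by omega))
        have h : fockAct K m n ((cliffFock K m n).lamProd I.toList.reverse)
            ((cliffFock K m n).vec J.toList) = 0 :=
          FockSystem.act_lamProd_eq_zero_of_mem (D := cliffFock K m n) (i := i)
            (FockSystem.act_lam_vec (by simpa using hiJ)) (by simpa using hiI)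
        rw [map_mul, Module.End.mul_apply, h, map_zero]
      · intro h
        exact absurd (Finset.mem_powersetCard.2 ⟨Finset.subset_univ J, hJ⟩) h
    by_cases hd : L.Nodup
    · have hp : L.Perm L.toFinset.toList := (List.toFinset_toList hd).symm
      have hc : L.toFinset.card = a := by rw [List.toFinset_card_of_nodup hd, hL]
      rcases FockSystem.vec_perm (D := cliffFock K m n) hp with h | h
      · rw [h, key _ hc]
      · rw [h, map_neg, map_neg, key _ hc]
    · rw [FockSystem.vec_of_not_nodup hd, map_zero, map_zero]

theorem mem_iSup_sup_iSup_of_fockAct_vec_mem {a : ℕ} (ha : a ≤ m)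
    {w : CliffordAlgebra (qφ K m n)}
    (H : ∀ I : List (Fin m), I.length = a → fockAct K m n w ((cliffFock K m n).vec I) ∈
      LinearMap.range (ExteriorAlgebra.map (genφ K m n)).toLinearMap) :
    w ∈ (⨆ (r : ℕ) (t : ℕ), gPow K m n r * lamPow K m n (a + t)) ⊔
      (⨆ (p : ℕ) (t : ℕ), lamPow K m n p * gPow K m n (m + 1 - a + t)) := by
  obtain ⟨u, hu, huw⟩ := exists_fockAct_vec_eq H
  have h := leftIdeal_le_iSup_sup_iSup (mem_leftIdeal_of_fockAct_vec_eq_zero (w := w - u) ha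
    fun I hI => by rw [map_sub, LinearMap.sub_apply, huw I hI, sub_self])
  rw [← sub_add_cancel w u]
  refine add_mem ((?_ : _ ≤ (_ : Submodule _ _)) h) ((?_ : _ ≤ (_ : Submodule _ _)) hu)
  · refine sup_le_sup_right (iSup_mono fun r => iSup_le fun t => ?_) _
    exact le_iSup_of_le (1 + t) (by rw [add_assoc])
  · refine le_sup_of_le_left ?_
    rw [Submodule.iSup_mul]
    exact iSup_mono fun r => le_iSup_of_le 0 le_rfl

end kernel

theorem kernel_of_clifford_to_hom (K : Type) [Field K] (m n : ℕ)
    (hm : 0 < m) (hmn : m ≤ n)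
    (ρ : CliffordAlgebra (qφ K m n) →ₐ[detS K m n] Module.End (detS K m n) (detM K m n))
    -- `ρ(λ)` is the operator `∂_λ` induced by left contraction with `λ` on `Λ S^m`:
    (hρD : ∀ lam x, ρ (CliffordAlgebra.ι (qφ K m n) (lam, 0)) (detπ K m n x)
      = detπ K m n (ctr K m n lam x))
    -- `ρ(g)` is the operator `θ_g` induced by exterior multiplication with `φ(g)` on `Λ S^m`:
    (hρT : ∀ g x, ρ (CliffordAlgebra.ι (qφ K m n) (0, g)) (detπ K m n x)
      = detπ K m n (ExteriorAlgebra.ι (detS K m n) (genφ K m n g) * x)) :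
    ∀ a b : ℕ, 1 ≤ a → a ≤ m → 1 ≤ b → b ≤ m →
      ∀ w ∈ cliffDeg K m n ((b : ℤ) - (a : ℤ)),
        ((∀ x : ⋀[detS K m n]^a (Fin m → detS K m n),
            ρ w (detπ K m n (x : ExteriorAlgebra (detS K m n) (Fin m → detS K m n))) = 0)
          ↔ w ∈ (⨆ (k : ℕ) (_ : m < k), lamPow K m n (k - b) * gPow K m n (k - a)) ⊔
              (⨆ t : ℕ, gPow K m n (b + t) * lamPow K m n (a + t))) := by
  intro a b _ ham _ hbm w hw
  have hρ : ∀ w x, ρ w (detπ K m n x) = 0 ↔ fockAct K m n w x ∈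
      LinearMap.range (ExteriorAlgebra.map (genφ K m n)).toLinearMap := fun w x => by
    rw [rho_detπ ρ hρD hρT]
    exact Submodule.Quotient.mk_eq_zero _
  constructor
  · intro H
    refine mem_of_mem_cliffDeg ?_ hw (mem_iSup_sup_iSup_of_fockAct_vec_mem ham fun I hI =>
      (hρ _ _).1 (H ⟨_, hI ▸ vec_mem_exteriorPower I⟩))
    refine sup_le (iSup₂_le fun r t => le_comap_degProj (gPow_mul_lamPow_le_cliffDeg _ _)
      fun h => ?_) (iSup₂_le fun p t => le_comap_degProj (lamPow_mul_gPow_le_cliffDeg _ _)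
      fun h => ?_)
    · obtain rfl : r = b + t := by push_cast at h; omega
      exact le_sup_of_le_right (le_iSup_of_le t le_rfl)
    · have hp : p = m + 1 + t - b := by omega
      have hq : m + 1 - a + t = m + 1 + t - a := by omega
      rw [hp, hq]
      exact le_sup_of_le_left (le_iSup₂_of_le (m + 1 + t) (by omega) le_rfl)
  · intro hw' x
    refine (hρ w x).2 ((?_ : _ ≤ Submodule.comap ((fockAct K m n).toLinearMap.flip
      (x : ExteriorAlgebra (detS K m n) (Fin m → detS K m n)))
      (LinearMap.range (ExteriorAlgebra.map (genφ K m n)).toLinearMap)) hw')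
    refine sup_le (iSup₂_le fun k hk u hu => ?_) (iSup_le fun t u hu => ?_)
    · have h : fockAct K m n u (x : ExteriorAlgebra (detS K m n) (Fin m → detS K m n)) = 0 :=
        fockAct_lamPow_mul_gPow (by omega) hu x.2
      exact ⟨0, (map_zero _).trans h.symm⟩
    · exact fockAct_gPow_mul_lamPow_mem_range hu x.2

end
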